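/- Let p ∈ (-1, 0) and set r = 2/(p+1). Let u ∈ C_c^∞(ℝ²) be such that for every t ∈ (0, max |u|) the level set Ω_u(t) = {x ∈ ℝ² : |u(x)| > t} is connected and contains the origin. Then (∫_{ℝ²} |u(x)|^r dx)^{1/r} ≤ (π^{1/r}/(2π)) ∫_{ℝ²} |∇u(x)| |x|^p dx. -/

import Mathlib

open MeasureTheory Real


theorem hs_ftc_lintegral {a b : ℝ} (hab : a ≤ b) {F F' : ℝ → ℝ} (hc : ContinuousOn F (Set.Icc a b))
    (hd : ∀ x ∈ Set.Ioo a b, HasDerivAt F (F' x) x) (hn : ∀ x ∈ Set.Ioo a b, 0 ≤ F' x) :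
    ∫⁻ x in Set.Ioo a b, ENNReal.ofReal (F' x) = ENNReal.ofReal (F b - F a) := by
  have hi := intervalIntegral.integrableOn_deriv_of_nonneg hc hd hn
  have h1 : ∫ y in a..b, F' y = F b - F a :=
    intervalIntegral.integral_eq_sub_of_hasDerivAt_of_le hab hc hd
      ((intervalIntegrable_iff_integrableOn_Ioc_of_le hab).2 hi)
  rw [← h1, intervalIntegral.integral_of_le hab, integral_Ioc_eq_integral_Ioo]
  rw [ofReal_integral_eq_lintegral_ofReal (hi.mono_set Set.Ioo_subset_Ioc_self)]
  exact (ae_restrict_iff' measurableSet_Ioo).2 (Filter.Eventually.of_forall hn)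

theorem hs_arc {m : ℝ} (hm : 0 < m) (hm1 : m < 1) :
    ∫⁻ v in Set.Ioo m 1, ENNReal.ofReal (v / (√(1 - v ^ 2) * √(v ^ 2 - m ^ 2)))
      = ENNReal.ofReal (π / 2) := by
  have hm2 : 0 < 1 - m ^ 2 := by nlinarith
  rw [hs_ftc_lintegral (F := fun v => arcsin ((2 * v ^ 2 - 1 - m ^ 2) / (1 - m ^ 2)) / 2) hm1.le]
  · congr 1
    have e1 : (2 * (1:ℝ) ^ 2 - 1 - m ^ 2) / (1 - m ^ 2) = 1 := by field_simp; ring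
    have e2 : (2 * m ^ 2 - 1 - m ^ 2) / (1 - m ^ 2) = -1 := by field_simp; ring
    simp only [e1, e2, arcsin_one, arcsin_neg_one]; ring
  · exact (continuous_arcsin.comp (by fun_prop)).continuousOn.div_const _
  · rintro v ⟨h1, h2⟩
    have hv : 0 < v := hm.trans h1
    have p1 : 0 < 1 - v ^ 2 := by nlinarith
    have p2 : 0 < v ^ 2 - m ^ 2 := by nlinarith
    have hlo : (2 * v ^ 2 - 1 - m ^ 2) / (1 - m ^ 2) ≠ -1 := by
      intro h; rw [div_eq_iff hm2.ne'] at h; nlinarith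
    have hhi : (2 * v ^ 2 - 1 - m ^ 2) / (1 - m ^ 2) ≠ 1 := by
      intro h; rw [div_eq_iff hm2.ne'] at h; nlinarith
    have hin : HasDerivAt (fun v : ℝ => (2 * v ^ 2 - 1 - m ^ 2) / (1 - m ^ 2)) (4 * v / (1 - m ^ 2)) v := by
      have := ((((hasDerivAt_id v).pow 2).const_mul 2).sub_const 1).sub_const (m ^ 2) |>.div_const (1 - m ^ 2)
      refine (this.congr_deriv ?_)
      simp; ring
    have := ((hasDerivAt_arcsin hlo hhi).comp v hin).div_const 2
    refine this.congr_deriv ?_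
    have e : 1 - ((2 * v ^ 2 - 1 - m ^ 2) / (1 - m ^ 2)) ^ 2
        = (2 * (√(1 - v ^ 2) * √(v ^ 2 - m ^ 2)) / (1 - m ^ 2)) ^ 2 := by
      rw [div_pow, div_pow, mul_pow, mul_pow, sq_sqrt p1.le, sq_sqrt p2.le]
      field_simp; ring
    have s1 := sqrt_pos.2 p1
    have s2 := sqrt_pos.2 p2
    rw [e, sqrt_sq (by positivity)]
    field_simp
    norm_num
  · rintro v ⟨h1, h2⟩
    have hv : 0 < v := hm.trans h1
    positivity

noncomputable def hsH (α g : ℝ) : ℝ := (α * g ^ (2 - α) + (2 - α) * g ^ (-α)) / 2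
noncomputable def hsQ (α g : ℝ) : ℝ := α * (2 - α) / 2 * (g ^ (2 - α) - g ^ (-α))

theorem hs_pair {α g k : ℝ} (h0 : 0 < α) (h2 : α < 2) (hg : 0 < g) (hk : 0 < k)
    (h : hsH α g = hsH α k) :
    -(hsQ α g * hsQ α k) ≤ α * (2 - α) * (hsH α g ^ 2 - 1) := by
  have hgk : 0 < g * k := by positivity
  have am := geom_mean_le_arith_mean2_weighted (w₁ := α / 2) (w₂ := 1 - α / 2)
    (p₁ := (g * k) ^ (2 - α)) (p₂ := (g * k) ^ (-α)) (by linarith) (by linarith)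
    (by positivity) (by positivity) (by ring)
  rw [← rpow_mul hgk.le, ← rpow_mul hgk.le, ← rpow_add hgk] at am
  have e0 : (2 - α) * (α / 2) + -α * (1 - α / 2) = 0 := by ring
  rw [e0, rpow_zero, mul_rpow hg.le hk.le, mul_rpow hg.le hk.le] at am
  have a2 : 0 < 2 - α := by linarith
  unfold hsH hsQ at *
  set G1 := g ^ (2 - α)
  set G2 := g ^ (-α)
  set K1 := k ^ (2 - α)
  set K2 := k ^ (-α)
  have hK1 : K1 = G1 + (2 - α) / α * (G2 - K2) := by
    field_simp; linarith
  have key : ((α * G1 + (2 - α) * G2) / 2) ^ 2 - 1 + α * (2 - α) / 4 * ((G1 - G2) * (K1 - K2)) ≥ 0 := by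
    have : ((α * G1 + (2 - α) * G2) / 2) ^ 2 + α * (2 - α) / 4 * ((G1 - G2) * (K1 - K2))
      = α / 2 * (G1 * K1) + (1 - α / 2) * (G2 * K2) := by
      rw [hK1]; field_simp; ring
    linarith
  have := mul_nonneg (mul_pos h0 a2).le key
  nlinarith


theorem hs_f_deriv {α m T x : ℝ} (hT : 0 < T) (hx : 0 < x) :
    HasDerivAt (fun x => m * hsH α (x / T)) (m * hsQ α (x / T) / x) x := by
  have hg : 0 < x / T := div_pos hx hT
  have d0 : HasDerivAt (fun x : ℝ => x / T) (1 / T) x := (hasDerivAt_id x).div_const T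
  have d1 := d0.rpow_const (p := 2 - α) (Or.inl hg.ne')
  have d2 := d0.rpow_const (p := -α) (Or.inl hg.ne')
  have := (((d1.const_mul α).add (d2.const_mul (2 - α))).div_const 2).const_mul m
  refine this.congr_deriv ?_
  unfold hsQ
  have e1 : (x / T) ^ (2 - α - 1) = (x / T) ^ (2 - α) / (x / T) := by rw [rpow_sub_one hg.ne']
  have e2 : (x / T) ^ (-α - 1) = (x / T) ^ (-α) / (x / T) := by rw [rpow_sub_one hg.ne']
  rw [e1, e2]
  field_simp
  ring

theorem hsQ_pos {α g : ℝ} (h0 : 0 < α) (h2 : α < 2) (hg : 1 < g) : 0 < hsQ α g := by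
  unfold hsQ
  have := rpow_lt_rpow_of_exponent_lt hg (show -α < 2 - α by linarith)
  have h3 : 0 < 2 - α := by linarith
  have : 0 < g ^ (2 - α) - g ^ (-α) := by linarith
  positivity

theorem hsQ_neg {α g : ℝ} (h0 : 0 < α) (h2 : α < 2) (hg0 : 0 < g) (hg : g < 1) : hsQ α g < 0 := by
  unfold hsQ
  have := rpow_lt_rpow_of_exponent_gt hg0 hg (show -α < 2 - α by linarith)
  have h3 : 0 < 2 - α := by linarith
  exact mul_neg_of_pos_of_neg (by positivity) (by linarith)

theorem hs_theta {α m T : ℝ} (h0 : 0 < α) (h2 : α < 2) (hm : 0 < m) (hm1 : m < 1) (hT : 0 < T) :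
    ENNReal.ofReal π ≤ ∫⁻ x in Set.Ioi (0:ℝ),
      ENNReal.ofReal (m * hsH α (x / T) / (x * √(1 - (m * hsH α (x / T)) ^ 2))) := by
  have h3 : 0 < 2 - α := by linarith
  set f : ℝ → ℝ := fun x => m * hsH α (x / T) with hf
  have hder : ∀ x, 0 < x → HasDerivAt f (m * hsQ α (x / T) / x) x := fun x hx => hs_f_deriv hT hx
  have hcont : ContinuousOn f (Set.Ioi 0) := fun x hx => (hder x hx).continuousAt.continuousWithinAt
  have hfT : f T = m := by simp [hf, hsH, div_self hT.ne']
  have hmono : StrictMonoOn f (Set.Ici T) := by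
    refine strictMonoOn_of_deriv_pos (convex_Ici T) (hcont.mono fun x hx => hT.trans_le hx) ?_
    intro x hx
    rw [interior_Ici] at hx
    have hx0 : 0 < x := hT.trans hx
    rw [(hder x hx0).deriv]
    have := hsQ_pos h0 h2 ((one_lt_div hT).2 hx)
    positivity
  have hanti : StrictAntiOn f (Set.Ioc 0 T) := by
    refine strictAntiOn_of_deriv_neg (convex_Ioc 0 T) (hcont.mono fun x hx => hx.1) ?_
    intro x hx
    rw [interior_Ioc] at hx
    rw [(hder x hx.1).deriv]
    have := hsQ_neg h0 h2 (div_pos hx.1 hT) ((div_lt_one hT).2 hx.2)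
    exact div_neg_of_neg_of_pos (mul_neg_of_pos_of_neg hm this) hx.1
  have hex2 : ∀ v : ℝ, ∃ x, v ∈ Set.Ioo m 1 → T < x ∧ f x = v := by
    intro v
    by_cases hv : v ∈ Set.Ioo m 1
    swap
    · exact ⟨0, fun h => absurd h hv⟩
    set K := 2 / (m * α) with hK
    have hK0 : 0 < K := by positivity
    set g := (max K 1) ^ (2 - α)⁻¹ with hg
    have hg1 : 1 ≤ g := one_le_rpow (le_max_right _ _) (by positivity)
    have hgp : g ^ (2 - α) = max K 1 := by
      rw [hg, ← rpow_mul (by positivity), inv_mul_cancel₀ h3.ne', rpow_one]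
    have hbig : 1 ≤ f (T * g) := by
      have : 0 ≤ g ^ (-α) := by positivity
      simp only [hf, hsH]
      rw [mul_div_cancel_left₀ _ hT.ne', hgp]
      have h4 : K ≤ max K 1 := le_max_left _ _
      have : m * ((α * K) / 2) ≤ m * ((α * max K 1 + (2 - α) * g ^ (-α)) / 2) := by
        gcongr
        nlinarith [mul_le_mul_of_nonneg_left h4 h0.le, mul_nonneg h3.le this]
      refine le_trans (le_of_eq ?_) this
      rw [hK]; field_simp
    have hTg : T ≤ T * g := by nlinarith
    obtain ⟨x, hx, hxv⟩ := intermediate_value_Icc hTg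
      (hcont.mono fun x hx => hT.trans_le hx.1) (show v ∈ Set.Icc (f T) (f (T * g)) from
        ⟨by rw [hfT]; exact hv.1.le, hv.2.le.trans hbig⟩)
    refine ⟨x, fun _ => ⟨lt_of_le_of_ne hx.1 ?_, hxv⟩⟩
    rintro rfl
    rw [hfT] at hxv
    exact absurd hv.1 (by rw [hxv]; exact lt_irrefl _)
  have hex1 : ∀ v : ℝ, ∃ x, v ∈ Set.Ioo m 1 → (0 < x ∧ x < T) ∧ f x = v := by
    intro v
    by_cases hv : v ∈ Set.Ioo m 1
    swap
    · exact ⟨0, fun h => absurd h hv⟩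
    set K := 2 / (m * (2 - α)) with hK
    have hK0 : 0 < K := by positivity
    set g := (max K 1) ^ (-α)⁻¹ with hg
    have hM0 : 0 < max K 1 := lt_max_of_lt_left hK0
    have hg0 : 0 < g := rpow_pos_of_pos hM0 _
    have hg1 : g ≤ 1 := rpow_le_one_of_one_le_of_nonpos (le_max_right _ _) (inv_nonpos.2 (by linarith))
    have hgp : g ^ (-α) = max K 1 := by
      rw [hg, ← rpow_mul hM0.le, inv_mul_cancel₀ (by linarith), rpow_one]
    have hbig : 1 ≤ f (T * g) := by
      have : 0 ≤ g ^ (2 - α) := by positivity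
      simp only [hf, hsH]
      rw [mul_div_cancel_left₀ _ hT.ne', hgp]
      have h4 : K ≤ max K 1 := le_max_left _ _
      have : m * (((2 - α) * K) / 2) ≤ m * ((α * g ^ (2 - α) + (2 - α) * max K 1) / 2) := by
        gcongr
        nlinarith [mul_le_mul_of_nonneg_left h4 h3.le, mul_nonneg h0.le this]
      refine le_trans (le_of_eq ?_) this
      rw [hK]; field_simp
    have hTg : T * g ≤ T := by nlinarith
    have hTg0 : 0 < T * g := by positivity
    obtain ⟨x, hx, hxv⟩ := intermediate_value_Icc' hTg
      (hcont.mono fun x hx => hTg0.trans_le hx.1) (show v ∈ Set.Icc (f T) (f (T * g)) from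
        ⟨by rw [hfT]; exact hv.1.le, hv.2.le.trans hbig⟩)
    refine ⟨x, fun _ => ⟨⟨hTg0.trans_le hx.1, lt_of_le_of_ne hx.2 ?_⟩, hxv⟩⟩
    rintro rfl
    rw [hfT] at hxv
    exact absurd hv.1 (by rw [hxv]; exact lt_irrefl _)
  choose rp hrp using hex2
  choose rm hrm using hex1
  set S2 : Set ℝ := Set.Ioi T ∩ f ⁻¹' (Set.Iio 1) with hS2
  set S1 : Set ℝ := Set.Ioo 0 T ∩ f ⁻¹' (Set.Iio 1) with hS1
  have hfmeas : Measurable f := by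
    simp only [hf]; unfold hsH; fun_prop
  have mS2 : MeasurableSet S2 := measurableSet_Ioi.inter (hfmeas measurableSet_Iio)
  have mS1 : MeasurableSet S1 := measurableSet_Ioo.inter (hfmeas measurableSet_Iio)
  have inj2 : Set.InjOn f S2 := hmono.injOn.mono (fun x hx => Set.mem_Ici.2 (le_of_lt (Set.mem_Ioi.1 hx.1)))
  have inj1 : Set.InjOn f S1 := hanti.injOn.mono (fun x hx => Set.mem_Ioc.2 ⟨hx.1.1, hx.1.2.le⟩)
  have im2 : f '' S2 = Set.Ioo m 1 := by
    ext v; constructor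
    · rintro ⟨x, hx, rfl⟩
      refine ⟨?_, hx.2⟩
      rw [← hfT]; exact hmono Set.self_mem_Ici (Set.mem_Ici.2 (le_of_lt (Set.mem_Ioi.1 hx.1))) hx.1
    · intro hv
      exact ⟨rp v, ⟨(hrp v hv).1, by simp only [Set.mem_preimage, (hrp v hv).2]; exact hv.2⟩, (hrp v hv).2⟩
  have im1 : f '' S1 = Set.Ioo m 1 := by
    ext v; constructor
    · rintro ⟨x, hx, rfl⟩
      refine ⟨?_, hx.2⟩
      rw [← hfT]; exact hanti ⟨hx.1.1, hx.1.2.le⟩ ⟨hT, le_rfl⟩ hx.1.2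
    · intro hv
      exact ⟨rm v, ⟨(hrm v hv).1, by simp only [Set.mem_preimage, (hrm v hv).2]; exact hv.2⟩, (hrm v hv).2⟩
  have rpf : ∀ x ∈ S2, rp (f x) = x := by
    intro x hx
    have hv : f x ∈ Set.Ioo m 1 := im2 ▸ Set.mem_image_of_mem f hx
    exact hmono.injOn (Set.mem_Ici.2 (le_of_lt (hrp _ hv).1)) (Set.mem_Ici.2 (le_of_lt (Set.mem_Ioi.1 hx.1))) (hrp _ hv).2
  have rmf : ∀ x ∈ S1, rm (f x) = x := by
    intro x hx
    have hv : f x ∈ Set.Ioo m 1 := im1 ▸ Set.mem_image_of_mem f hx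
    exact hanti.injOn ⟨(hrm _ hv).1.1, (hrm _ hv).1.2.le⟩ ⟨hx.1.1, hx.1.2.le⟩ (hrm _ hv).2
  have rpmono : MonotoneOn rp (Set.Ioo m 1) := by
    intro v hv w hw hvw
    by_contra hlt
    push Not at hlt
    have := hmono (le_of_lt (hrp w hw).1) (le_of_lt (hrp v hv).1) hlt
    rw [(hrp w hw).2, (hrp v hv).2] at this
    linarith
  set G2 : ℝ → ENNReal := fun v => ENNReal.ofReal (v / √(1 - v ^ 2) / (m * hsQ α (rp v / T))) with hG2
  set G1 : ℝ → ENNReal := fun v => ENNReal.ofReal (v / √(1 - v ^ 2) / (-(m * hsQ α (rm v / T)))) with hG1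
  have G2m : AEMeasurable G2 (volume.restrict (Set.Ioo m 1)) := by
    have := aemeasurable_restrict_of_monotoneOn (μ := volume) measurableSet_Ioo rpmono
    have hq : Measurable (hsQ α) := by unfold hsQ; fun_prop
    refine AEMeasurable.ennreal_ofReal ?_
    refine AEMeasurable.div (by fun_prop) ?_
    exact (hq.comp_aemeasurable (this.div_const T)).const_mul m
  have I2 : ∫⁻ v in Set.Ioo m 1, G2 v = ∫⁻ x in S2, ENNReal.ofReal (f x / (x * √(1 - (f x) ^ 2))) := by
    rw [← im2, lintegral_image_eq_lintegral_abs_deriv_mul mS2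
      (fun x hx => (hder x (hT.trans hx.1)).hasDerivWithinAt) inj2]
    refine setLIntegral_congr_fun mS2 ?_
    intro x hx
    have hx0 : 0 < x := hT.trans hx.1
    have hq : 0 < m * hsQ α (x / T) := mul_pos hm (hsQ_pos h0 h2 ((one_lt_div hT).2 hx.1))
    simp only [hG2]
    rw [rpf x hx, ← ENNReal.ofReal_mul (abs_nonneg _), abs_of_pos (div_pos hq hx0)]
    congr 1
    have hq' : hsQ α (x / T) ≠ 0 := fun h => by simp [h] at hq
    field_simp
  have I1 : ∫⁻ v in Set.Ioo m 1, G1 v = ∫⁻ x in S1, ENNReal.ofReal (f x / (x * √(1 - (f x) ^ 2))) := by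
    rw [← im1, lintegral_image_eq_lintegral_abs_deriv_mul mS1
      (fun x hx => (hder x hx.1.1).hasDerivWithinAt) inj1]
    refine setLIntegral_congr_fun mS1 ?_
    intro x hx
    have hx0 : 0 < x := hx.1.1
    have hq : m * hsQ α (x / T) < 0 :=
      mul_neg_of_pos_of_neg hm (hsQ_neg h0 h2 (div_pos hx0 hT) ((div_lt_one hT).2 hx.1.2))
    simp only [hG1]
    rw [rmf x hx, ← ENNReal.ofReal_mul (abs_nonneg _), abs_of_neg (div_neg_of_neg_of_pos hq hx0)]
    congr 1
    have hq' : hsQ α (x / T) ≠ 0 := fun h => by simp [h] at hq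
    field_simp
  have hdisj : Disjoint S2 S1 := by
    rw [Set.disjoint_left]; intro x hx hx'
    exact absurd hx.1 (not_lt.2 hx'.1.2.le)
  have hpt : ∀ v ∈ Set.Ioo m 1,
      ENNReal.ofReal 2 * ENNReal.ofReal (v / (√(1 - v ^ 2) * √(v ^ 2 - m ^ 2))) ≤ G2 v + G1 v := by
    intro v hv
    have hv0 : 0 < v := hm.trans hv.1
    have p1 : 0 < 1 - v ^ 2 := by nlinarith [hv.2]
    have p2 : 0 < v ^ 2 - m ^ 2 := by nlinarith [hv.1]
    obtain ⟨a1, a2⟩ := hrp v hv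
    obtain ⟨⟨b0, b1⟩, b2⟩ := hrm v hv
    have hP : 0 < m * hsQ α (rp v / T) := mul_pos hm (hsQ_pos h0 h2 ((one_lt_div hT).2 a1))
    have hN : 0 < -(m * hsQ α (rm v / T)) := by
      have := mul_neg_of_pos_of_neg hm (hsQ_neg h0 h2 (div_pos b0 hT) ((div_lt_one hT).2 b1))
      linarith
    have hHe : hsH α (rp v / T) = hsH α (rm v / T) := by
      have : m * hsH α (rp v / T) = m * hsH α (rm v / T) := a2.trans b2.symm
      exact mul_left_cancel₀ hm.ne' this
    have pr := hs_pair h0 h2 (div_pos (hT.trans a1) hT) (div_pos b0 hT) hHe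
    have hle : (m * hsQ α (rp v / T)) * (-(m * hsQ α (rm v / T))) ≤ v ^ 2 - m ^ 2 := by
      have e1 : m ^ 2 * (α * (2 - α) * (hsH α (rp v / T) ^ 2 - 1)) = α * (2 - α) * (v ^ 2 - m ^ 2) := by
        have a3 : m * hsH α (rp v / T) = v := a2
        linear_combination (α * (2 - α)) * (m * hsH α (rp v / T) + v) * a3
      have := mul_le_mul_of_nonneg_left pr (sq_nonneg m)
      rw [e1] at this
      have a1' : α * (2 - α) ≤ 1 := by nlinarith [sq_nonneg (α - 1)]
      nlinarith
    simp only [hG1, hG2]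
    set P := m * hsQ α (rp v / T)
    set N := -(m * hsQ α (rm v / T))
    have s1 := sqrt_pos.2 p1
    have s2 := sqrt_pos.2 p2
    rw [← ENNReal.ofReal_mul (by norm_num), ← ENNReal.ofReal_add (by positivity) (by positivity)]
    apply ENNReal.ofReal_le_ofReal
    have hs : 2 * (P * N) ≤ √(v ^ 2 - m ^ 2) * (P + N) := by
      refine le_of_sq_le_sq ?_ (by positivity)
      rw [mul_pow, mul_pow √_, sq_sqrt p2.le]
      have hPN : 0 < P * N := by positivity
      nlinarith [sq_nonneg (P - N), mul_le_mul_of_nonneg_left hle hPN.le,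
        mul_nonneg p2.le (sq_nonneg (P - N))]
    have : 2 / √(v ^ 2 - m ^ 2) ≤ 1 / P + 1 / N := by
      rw [div_add_div _ _ hP.ne' hN.ne', div_le_div_iff₀ s2 (by positivity)]
      nlinarith
    calc 2 * (v / (√(1 - v ^ 2) * √(v ^ 2 - m ^ 2))) = v / √(1 - v ^ 2) * (2 / √(v ^ 2 - m ^ 2)) := by
          field_simp
      _ ≤ v / √(1 - v ^ 2) * (1 / P + 1 / N) := by gcongr
      _ = _ := by ring
  calc ENNReal.ofReal π = ENNReal.ofReal 2 * ENNReal.ofReal (π / 2) := by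
        rw [← ENNReal.ofReal_mul (by norm_num)]; congr 1; ring
    _ = ∫⁻ v in Set.Ioo m 1, ENNReal.ofReal 2 * ENNReal.ofReal (v / (√(1 - v ^ 2) * √(v ^ 2 - m ^ 2))) := by
        rw [lintegral_const_mul' _ _ ENNReal.ofReal_ne_top, hs_arc hm hm1]
    _ ≤ ∫⁻ v in Set.Ioo m 1, (G2 v + G1 v) := setLIntegral_mono' measurableSet_Ioo hpt
    _ = (∫⁻ v in Set.Ioo m 1, G2 v) + ∫⁻ v in Set.Ioo m 1, G1 v := lintegral_add_left' G2m _
    _ = ∫⁻ x in S2 ∪ S1, ENNReal.ofReal (f x / (x * √(1 - (f x) ^ 2))) := by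
        rw [I1, I2, lintegral_union mS1 hdisj]
    _ ≤ _ := lintegral_mono_set (by
        rintro x (hx | hx)
        · exact hT.trans hx.1
        · exact hx.1.1)


theorem hsH_one_le {α g : ℝ} (h0 : 0 < α) (h2 : α < 2) (hg : 0 < g) : 1 ≤ hsH α g := by
  have := Real.geom_mean_le_arith_mean2_weighted (w₁ := α / 2) (w₂ := (2 - α) / 2)
    (p₁ := g ^ (2 - α)) (p₂ := g ^ (-α)) (by linarith) (by linarith) (by positivity) (by positivity)
    (by ring)
  rw [← rpow_mul hg.le, ← rpow_mul hg.le, ← rpow_add hg] at this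
  have e : (2 - α) * (α / 2) + -α * ((2 - α) / 2) = 0 := by ring
  rw [e, rpow_zero] at this
  unfold hsH
  linarith

theorem hs_theta' {α μ c x : ℝ} (h0 : 0 < α) (h2 : α < 2) (hμ : 0 < μ) (hc : 0 < c) (hx : 0 < x)
    (hlt : c + μ * x ^ 2 < x ^ α) :
    ENNReal.ofReal π ≤ ∫⁻ ρ in Set.Ioi (0 : ℝ), ENNReal.ofReal
      ((c + μ * ρ ^ 2) / ρ ^ α / (ρ * √(1 - ((c + μ * ρ ^ 2) / ρ ^ α) ^ 2))) := by
  have h3 : 0 < 2 - α := by linarith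
  set T := √(α * c / ((2 - α) * μ)) with hT
  have hT0 : 0 < T := sqrt_pos.2 (by positivity)
  have hT2 : T ^ 2 = α * c / ((2 - α) * μ) := sq_sqrt (by positivity)
  set m := 2 * μ * T ^ (2 - α) / α with hm
  have hm0 : 0 < m := by positivity
  have key : ∀ ρ : ℝ, 0 < ρ → m * hsH α (ρ / T) = (c + μ * ρ ^ 2) / ρ ^ α := by
    intro ρ hρ
    unfold hsH
    rw [div_rpow hρ.le hT0.le, div_rpow hρ.le hT0.le, rpow_neg hρ.le, rpow_neg hT0.le,
      rpow_sub hρ, rpow_two, hm, rpow_sub hT0, rpow_two]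
    have a1 : 0 < ρ ^ α := by positivity
    have a2 : 0 < T ^ α := by positivity
    have e : c = T ^ 2 * (2 - α) * μ / α := by rw [hT2]; field_simp
    rw [e]
    field_simp
    ring
  have hm1 : m < 1 := by
    calc m = m * 1 := by ring
      _ ≤ m * hsH α (x / T) := by
        gcongr; exact hsH_one_le h0 h2 (by positivity)
      _ = (c + μ * x ^ 2) / x ^ α := key x hx
      _ < 1 := by rw [div_lt_one (by positivity)]; exact hlt
  refine (hs_theta h0 h2 hm0 hm1 hT0).trans (le_of_eq ?_)
  refine setLIntegral_congr_fun measurableSet_Ioi ?_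
  intro ρ hρ
  simp only
  rw [key ρ hρ]

theorem hs_J {α μ c x : ℝ} (h0 : 0 < α) (h2 : α < 2) (hμ : 0 < μ) (hc : 0 ≤ c) (hx : 0 < x) :
    ENNReal.ofReal (π * (x ^ α - μ * x ^ 2 - c)) ≤ ∫⁻ ρ in Set.Ioi (0 : ℝ), ENNReal.ofReal
      (ρ ^ (α - 1) * √(1 - ((c + μ * ρ ^ 2) / ρ ^ α) ^ 2)) := by
  set d := x ^ α - μ * x ^ 2 - c with hd
  rcases le_or_gt d 0 with hd0 | hd0
  · rw [ENNReal.ofReal_of_nonpos (by nlinarith [pi_pos])]; exact zero_le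
  set G : ℝ → ℝ → ENNReal := fun c' ρ => ENNReal.ofReal
      ((c' + μ * ρ ^ 2) / ρ ^ α / (ρ * √(1 - ((c' + μ * ρ ^ 2) / ρ ^ α) ^ 2))) with hG
  have hGm : Measurable (Function.uncurry G) := by
    simp only [hG, Function.uncurry_def]; fun_prop
  have hzero : ∀ ρ > (0 : ℝ), ∀ c', ρ ^ α - μ * ρ ^ 2 ≤ c' → G c' ρ = 0 := by
    intro ρ hρ c' h
    have : 1 ≤ (c' + μ * ρ ^ 2) / ρ ^ α := by
      rw [one_le_div (by positivity)]; linarith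
    simp only [hG]
    rw [sqrt_eq_zero_of_nonpos (by nlinarith)]; simp
  calc ENNReal.ofReal (π * d) = ∫⁻ c' in Set.Ioo c (c + d), ENNReal.ofReal π := by
        rw [setLIntegral_const, Real.volume_Ioo, ← ENNReal.ofReal_mul pi_pos.le]; congr 1; ring
    _ ≤ ∫⁻ c' in Set.Ioo c (c + d), ∫⁻ ρ in Set.Ioi (0 : ℝ), G c' ρ := by
        refine setLIntegral_mono' measurableSet_Ioo ?_
        intro c' hc'
        exact hs_theta' h0 h2 hμ (hc.trans_lt hc'.1) hx (by linarith [hc'.2])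
    _ = ∫⁻ ρ in Set.Ioi (0 : ℝ), ∫⁻ c' in Set.Ioo c (c + d), G c' ρ :=
        lintegral_lintegral_swap hGm.aemeasurable
    _ ≤ _ := by
        refine setLIntegral_mono' measurableSet_Ioi ?_
        intro ρ hρ
        have hρ : 0 < ρ := hρ
        set e := ρ ^ α - μ * ρ ^ 2 with he
        have hI : ∫⁻ c' in Set.Ici e, G c' ρ = 0 := by
          rw [setLIntegral_congr_fun (g := fun _ => 0) measurableSet_Ici (fun c' h => hzero ρ hρ c' h)]
          simp
        have hP : 0 < ρ ^ α := by positivity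
        rcases le_or_gt e c with h | h
        · refine (lintegral_mono_set (t := Set.Ici e) ?_).trans (hI.le.trans zero_le)
          intro y hy; exact h.trans hy.1.le
        · have hsub : Set.Ioo c (c + d) ⊆ Set.Ioo c e ∪ Set.Ici e := by
            intro y hy
            rcases lt_or_ge y e with h' | h'
            · exact Or.inl ⟨hy.1, h'⟩
            · exact Or.inr h'
          refine (lintegral_mono_set hsub).trans ((lintegral_union_le _ _ _).trans ?_)
          rw [hI, add_zero]
          have hb : ∀ y ∈ Set.Ioo c e, 0 < 1 - ((y + μ * ρ ^ 2) / ρ ^ α) ^ 2 := by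
            intro y hy
            have h1 : (y + μ * ρ ^ 2) / ρ ^ α < 1 := by
              rw [div_lt_one hP]; linarith [hy.2]
            have h2 : 0 ≤ (y + μ * ρ ^ 2) / ρ ^ α := by
              have : 0 ≤ y := hc.trans hy.1.le
              positivity
            nlinarith
          rw [show (∫⁻ c' in Set.Ioo c e, G c' ρ) = _ from
            hs_ftc_lintegral (F := fun y => -(ρ ^ (α - 1) * √(1 - ((y + μ * ρ ^ 2) / ρ ^ α) ^ 2)))
              h.le ?_ ?_ ?_]
          · apply ENNReal.ofReal_le_ofReal
            have : (e + μ * ρ ^ 2) / ρ ^ α = 1 := by rw [he]; field_simp; ring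
            simp [this]
          · fun_prop
          · intro y hy
            have hs := hb y hy
            have d1 : HasDerivAt (fun y : ℝ => 1 - ((y + μ * ρ ^ 2) / ρ ^ α) ^ 2)
                (-(2 * ((y + μ * ρ ^ 2) / ρ ^ α) * (1 / ρ ^ α))) y := by
              have := ((((hasDerivAt_id y).add_const (μ * ρ ^ 2)).div_const (ρ ^ α)).pow 2).const_sub 1
              refine this.congr_deriv ?_
              simp
            have d2 := ((d1.sqrt hs.ne').const_mul (ρ ^ (α - 1))).neg
            refine HasDerivAt.congr_deriv (f := fun y => -(ρ ^ (α - 1) * √(1 - ((y + μ * ρ ^ 2) / ρ ^ α) ^ 2))) d2 ?_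
            have := sqrt_pos.2 hs
            rw [rpow_sub_one hρ.ne']
            set S := √(1 - ((y + μ * ρ ^ 2) / ρ ^ α) ^ 2)
            field_simp
          · intro y hy
            have : 0 ≤ y := hc.trans hy.1.le
            positivity


theorem hs_chord {α a b : ℝ} (h0 : 0 < α) (h1 : α < 1) (ha : 0 ≤ a) (hab : a ≤ b) (hb : 0 < b) :
    ∃ μ c : ℝ, 0 < μ ∧ 0 ≤ c ∧ c + μ * a ^ 2 = a ^ α ∧ c + μ * b ^ 2 = b ^ α ∧
      (∀ ρ, 0 ≤ ρ → ρ ∉ Set.Ioo a b → ρ ^ α ≤ c + μ * ρ ^ 2) ∧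
      (∀ ρ ∈ Set.Ioo a b, c + μ * ρ ^ 2 ≤ ρ ^ α) := by
  have hsq : ∀ ρ : ℝ, 0 ≤ ρ → ρ ^ α = (ρ ^ 2) ^ (α / 2) := by
    intro ρ hρ
    rw [← rpow_natCast, ← rpow_mul hρ]; congr 1; push_cast; ring
  suffices H : ∃ μ c : ℝ, 0 < μ ∧ c + μ * a ^ 2 = a ^ α ∧ c + μ * b ^ 2 = b ^ α ∧
      (∀ ρ, 0 ≤ ρ → ρ ∉ Set.Ioo a b → ρ ^ α ≤ c + μ * ρ ^ 2) ∧
      (∀ ρ ∈ Set.Ioo a b, c + μ * ρ ^ 2 ≤ ρ ^ α) by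
    obtain ⟨μ, c, p1, p2, p3, p4, p5⟩ := H
    refine ⟨μ, c, p1, ?_, p2, p3, p4, p5⟩
    have := p4 0 le_rfl (fun h => absurd h.1 (not_lt.2 ha))
    rw [zero_rpow h0.ne'] at this
    linarith
  rcases hab.eq_or_lt with rfl | hlt
  · refine ⟨α / 2 * a ^ α / a ^ 2, (1 - α / 2) * a ^ α, by positivity, ?_, ?_, ?_, ?_⟩
    · field_simp; ring
    · field_simp; ring
    · intro ρ hρ _
      have := rpow_one_add_le_one_add_mul_self (s := ρ ^ 2 / a ^ 2 - 1) (p := α / 2)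
        (by linarith [show 0 ≤ ρ ^ 2 / a ^ 2 by positivity]) (by linarith) (by linarith)
      rw [show 1 + (ρ ^ 2 / a ^ 2 - 1) = ρ ^ 2 / a ^ 2 by ring, div_rpow (by positivity) (by positivity),
        ← hsq ρ hρ, ← hsq a ha, div_le_iff₀ (by positivity)] at this
      refine this.trans (le_of_eq ?_)
      field_simp; ring
    · intro ρ hρ; exact absurd (hρ.1.trans hρ.2) (lt_irrefl _)
  · have hs : a ^ 2 < b ^ 2 := by nlinarith
    have hp : a ^ α < b ^ α := rpow_lt_rpow ha hlt h0
    have hd : 0 < b ^ 2 - a ^ 2 := by linarith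
    have hcon := Real.concaveOn_rpow (p := α / 2) (by linarith) (by linarith)
    set μ := (b ^ α - a ^ α) / (b ^ 2 - a ^ 2) with hμ
    have hμe : μ * (b ^ 2 - a ^ 2) = b ^ α - a ^ α := div_mul_cancel₀ _ hd.ne'
    have tri : ∀ x y z : ℝ, 0 ≤ x → x < y → y < z →
        (z ^ α - y ^ α) * (y ^ 2 - x ^ 2) ≤ (y ^ α - x ^ α) * (z ^ 2 - y ^ 2) := by
      intro x y z hx hxy hyz
      have hy := hx.trans hxy.le
      have hz := hy.trans hyz.le
      have s1 : x ^ 2 < y ^ 2 := by nlinarith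
      have s2 : y ^ 2 < z ^ 2 := by nlinarith
      have := hcon.slope_anti_adjacent (Set.mem_Ici.2 (sq_nonneg x)) (Set.mem_Ici.2 (sq_nonneg z)) s1 s2
      rw [← hsq x hx, ← hsq y hy, ← hsq z hz, div_le_div_iff₀ (by linarith) (by linarith)] at this
      exact this
    refine ⟨μ, a ^ α - μ * a ^ 2, div_pos (by linarith) hd, by ring, by linarith, ?_, ?_⟩
    · intro ρ hρ hn
      rcases lt_trichotomy ρ a with h | h | h
      · have := tri ρ a b hρ h hlt
        rw [← hμe] at this
        have : (μ * (a ^ 2 - ρ ^ 2)) * (b ^ 2 - a ^ 2) ≤ (a ^ α - ρ ^ α) * (b ^ 2 - a ^ 2) := by linarith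
        have := le_of_mul_le_mul_right this hd
        linarith
      · rw [h]; linarith
      · have hbr : b ≤ ρ := by
          by_contra hh; exact hn ⟨h, not_le.1 hh⟩
        rcases hbr.eq_or_lt with h' | h'
        · rw [← h']; linarith
        · have := tri a b ρ ha hlt h'
          rw [← hμe] at this
          have : (ρ ^ α - b ^ α) * (b ^ 2 - a ^ 2) ≤ (μ * (ρ ^ 2 - b ^ 2)) * (b ^ 2 - a ^ 2) := by linarith
          have := le_of_mul_le_mul_right this hd
          linarith
    · intro ρ hρ
      have := tri a ρ b ha hρ.1 hρ.2
      have : (μ * (ρ ^ 2 - a ^ 2)) * (b ^ 2 - a ^ 2) ≤ (ρ ^ α - a ^ α) * (b ^ 2 - a ^ 2) := by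
        have e : (μ * (ρ ^ 2 - a ^ 2)) * (b ^ 2 - a ^ 2) = (b ^ α - a ^ α) * (ρ ^ 2 - a ^ 2) := by
          rw [← hμe]; ring
        rw [e]; linarith
      have := le_of_mul_le_mul_right this hd
      linarith

theorem hs_le_lint {a b : ℝ} (hab : a ≤ b) (g : ℝ → ℝ) :
    ENNReal.ofReal (∫ x in a..b, g x) ≤ ∫⁻ x in Set.Ioo a b, ENNReal.ofReal |g x| := by
  rw [intervalIntegral.integral_of_le hab, integral_Ioc_eq_integral_Ioo]
  refine (ENNReal.ofReal_le_ofReal (le_abs_self _)).trans ?_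
  rw [← Real.enorm_eq_ofReal_abs]
  refine (enorm_integral_le_lintegral_enorm _).trans (le_of_eq ?_)
  refine lintegral_congr fun x => ?_
  rw [Real.enorm_eq_ofReal_abs]

theorem hs_radial {α a b M μ c : ℝ} (h0 : 0 < α) (ha : 0 ≤ a) (hab : a ≤ b) (hbM : b ≤ M)
    (hμ : 0 < μ) (hc : 0 ≤ c) (ea : c + μ * a ^ 2 = a ^ α) (eb : c + μ * b ^ 2 = b ^ α)
    {f f' : ℝ → ℝ} (hf : ∀ x, HasDerivAt f (f' x) x) (hf' : Continuous f') (hn : ∀ x, 0 ≤ f x)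
    (fa : f a = 1) (fM : f M = 0) :
    ENNReal.ofReal (a ^ α) + ∫⁻ ρ in Set.Ioo a b, ENNReal.ofReal (2 * μ * ρ * f ρ) ≤
      (∫⁻ ρ in Set.Ioo a b, ENNReal.ofReal ((c + μ * ρ ^ 2) * |f' ρ|)) +
        ∫⁻ ρ in Set.Ioi b, ENNReal.ofReal (ρ ^ α * |f' ρ|) := by
  have hfc : Continuous f := continuous_iff_continuousAt.2 fun x => (hf x).continuousAt
  have hk : ∀ x : ℝ, HasDerivAt (fun ρ : ℝ => c + μ * ρ ^ 2) (2 * μ * x) x := by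
    intro x
    refine (((hasDerivAt_pow 2 x).const_mul μ).const_add c).congr_deriv ?_
    push_cast; ring
  have ibp := intervalIntegral.integral_mul_deriv_eq_deriv_mul (a := a) (b := b)
    (u := fun ρ : ℝ => c + μ * ρ ^ 2) (u' := fun ρ => 2 * μ * ρ) (v := f) (v' := f')
    (fun x _ => hk x) (fun x _ => hf x) (Continuous.intervalIntegrable (by fun_prop) _ _)
    (hf'.intervalIntegrable _ _)
  have hM : ∫ x in b..M, f' x = f M - f b :=
    intervalIntegral.integral_eq_sub_of_hasDerivAt (fun x _ => hf x) (hf'.intervalIntegrable _ _)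
  have e1 : ∫⁻ ρ in Set.Ioo a b, ENNReal.ofReal (2 * μ * ρ * f ρ)
      = ENNReal.ofReal (∫ ρ in a..b, 2 * μ * ρ * f ρ) := by
    rw [intervalIntegral.integral_of_le hab, integral_Ioc_eq_integral_Ioo,
      ofReal_integral_eq_lintegral_ofReal]
    · have : Continuous fun ρ => 2 * μ * ρ * f ρ := by fun_prop
      exact (this.integrableOn_Icc (a := a) (b := b)).mono_set Set.Ioo_subset_Icc_self
    · refine (ae_restrict_iff' measurableSet_Ioo).2 (Filter.Eventually.of_forall ?_)
      intro x hx
      have : 0 ≤ x := ha.trans hx.1.le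
      have := hn x
      positivity
  have e2 : ENNReal.ofReal (∫ ρ in a..b, (c + μ * ρ ^ 2) * (-f' ρ)) ≤
      ∫⁻ ρ in Set.Ioo a b, ENNReal.ofReal ((c + μ * ρ ^ 2) * |f' ρ|) := by
    refine (hs_le_lint hab _).trans (le_of_eq ?_)
    refine lintegral_congr fun x => ?_
    rw [abs_mul, abs_neg, abs_of_nonneg (by positivity : 0 ≤ c + μ * x ^ 2)]
  have e3 : ENNReal.ofReal (∫ ρ in b..M, b ^ α * (-f' ρ)) ≤
      ∫⁻ ρ in Set.Ioi b, ENNReal.ofReal (ρ ^ α * |f' ρ|) := by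
    refine (hs_le_lint hbM _).trans ?_
    refine (setLIntegral_mono' measurableSet_Ioo ?_).trans (lintegral_mono_set Set.Ioo_subset_Ioi_self)
    intro x hx
    apply ENNReal.ofReal_le_ofReal
    have hb : 0 ≤ b := ha.trans hab
    rw [abs_mul, abs_neg, abs_of_nonneg (by positivity : 0 ≤ b ^ α)]
    gcongr
    exact hx.1.le
  have e4 : ∫ ρ in a..b, (c + μ * ρ ^ 2) * (-f' ρ) = a ^ α - b ^ α * f b + ∫ ρ in a..b, 2 * μ * ρ * f ρ := by
    simp only [mul_neg]
    rw [intervalIntegral.integral_neg, ibp, ea, eb, fa]; ring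
  have e5 : ∫ ρ in b..M, b ^ α * (-f' ρ) = b ^ α * f b := by
    rw [intervalIntegral.integral_const_mul, intervalIntegral.integral_neg, hM, fM]; ring
  have i0 : 0 ≤ ∫ ρ in a..b, 2 * μ * ρ * f ρ := by
    apply intervalIntegral.integral_nonneg hab
    intro x hx
    have : 0 ≤ x := ha.trans hx.1
    have := hn x
    positivity
  rw [e1, ← ENNReal.ofReal_add (by positivity) i0]
  refine le_trans ?_ (add_le_add e2 e3)
  refine le_trans (ENNReal.ofReal_le_ofReal ?_) ENNReal.ofReal_add_le
  rw [e4, e5]; linarith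

theorem hs_angular {f f' : ℝ → ℝ} (hf : ∀ x, HasDerivAt f (f' x) x) (hf' : Continuous f')
    (hp : Function.Periodic f (2 * π)) {x₁ x₂ : ℝ} (h1 : f x₁ = 1) (h2 : f x₂ = 0) :
    ENNReal.ofReal 2 ≤ ∫⁻ θ in Set.Ioo (-π) π, ENNReal.ofReal |f' θ| := by
  have hp' : Function.Periodic f' (2 * π) := by
    intro x
    have := (hf (x + 2 * π)).comp_add_const x (2 * π)
    have e : (fun x => f (x + 2 * π)) = f := funext hp
    rw [e] at this
    exact this.unique (hf x)
  obtain ⟨y, hy, hfy⟩ := hp.exists_mem_Ico (by positivity) x₂ x₁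
  rw [h2] at hfy
  have hc : Continuous fun θ => |f' θ| := hf'.abs
  have q : ∀ a b, ∫ θ in a..b, f' θ = f b - f a := fun a b =>
    intervalIntegral.integral_eq_sub_of_hasDerivAt (fun x _ => hf x) (hf'.intervalIntegrable _ _)
  have key : 2 ≤ ∫ θ in (-π)..π, |f' θ| := by
    have hpa : Function.Periodic (fun θ => |f' θ|) (2 * π) := fun x => by simp [hp' x]
    have e := hpa.intervalIntegral_add_eq (-π) x₁
    rw [show -π + 2 * π = π by ring] at e
    rw [e, ← intervalIntegral.integral_add_adjacent_intervals (b := y) (hc.intervalIntegrable _ _)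
      (hc.intervalIntegrable _ _)]
    have b1 := intervalIntegral.abs_integral_le_integral_abs (f := f') (μ := volume) hy.1
    have b2 := intervalIntegral.abs_integral_le_integral_abs (f := f') (μ := volume) hy.2.le
    rw [q] at b1 b2
    rw [hp x₁, h1, ← hfy] at b2
    rw [h1, ← hfy] at b1
    norm_num at b1 b2
    linarith
  refine (ENNReal.ofReal_le_ofReal key).trans ((hs_le_lint (by linarith [pi_pos]) _).trans ?_)
  simp


noncomputable def hsV (a b : ℝ) : EuclideanSpace ℝ (Fin 2) :=
  a • EuclideanSpace.single 0 1 + b • EuclideanSpace.single 1 1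

theorem hsV_eq (a b : ℝ) : hsV a b = !₂[a, b] := by
  ext i; fin_cases i <;> simp [hsV]

theorem hsV_norm (a b : ℝ) : ‖hsV a b‖ = √(a ^ 2 + b ^ 2) := by
  rw [hsV_eq, EuclideanSpace.norm_eq]; simp [Fin.sum_univ_two]

noncomputable def hsP (ρ θ : ℝ) : EuclideanSpace ℝ (Fin 2) := hsV (ρ * cos θ) (ρ * sin θ)

theorem hsP_norm (ρ θ : ℝ) : ‖hsP ρ θ‖ = |ρ| := by
  rw [hsP, hsV_norm, ← sqrt_sq_eq_abs]; congr 1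
  linear_combination ρ ^ 2 * (cos_sq_add_sin_sq θ)

theorem hsP_surj (x : EuclideanSpace ℝ (Fin 2)) : ∃ θ, x = hsP ‖x‖ θ := by
  set z : ℂ := ⟨x 0, x 1⟩ with hz
  have hn : ‖z‖ = ‖x‖ := by
    rw [Complex.norm_def, Complex.normSq_apply, EuclideanSpace.norm_eq]
    simp [Fin.sum_univ_two, hz]
    ring_nf
  refine ⟨z.arg, ?_⟩
  have h1 := Complex.norm_mul_cos_arg z
  have h2 := Complex.norm_mul_sin_arg z
  rw [hn] at h1 h2
  rw [hsP, h1, h2, hsV_eq]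
  ext i; fin_cases i <;> simp [hz]

theorem hsP_cont : Continuous (Function.uncurry hsP) := by
  unfold Function.uncurry hsP hsV; fun_prop

theorem hsP_periodic (ρ : ℝ) : Function.Periodic (hsP ρ) (2 * π) := by
  intro θ; simp [hsP]

theorem hsP_zero (θ : ℝ) : hsP 0 θ = 0 := by simp [hsP, hsV]

theorem hsP_deriv_r (ρ θ : ℝ) : HasDerivAt (fun r => hsP r θ) (hsV (cos θ) (sin θ)) ρ := by
  unfold hsP hsV
  refine HasDerivAt.add ?_ ?_
  · exact (((hasDerivAt_id ρ).mul_const (cos θ)).congr_deriv (one_mul _)).smul_const _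
  · exact (((hasDerivAt_id ρ).mul_const (sin θ)).congr_deriv (one_mul _)).smul_const _

theorem hsP_deriv_t (ρ θ : ℝ) : HasDerivAt (fun t => hsP ρ t) (ρ • hsV (-sin θ) (cos θ)) θ := by
  unfold hsP hsV
  rw [smul_add, smul_smul, smul_smul]
  refine HasDerivAt.add ?_ ?_
  · exact ((hasDerivAt_cos θ).const_mul ρ).smul_const _
  · exact ((hasDerivAt_sin θ).const_mul ρ).smul_const _

theorem hs_polar {g : EuclideanSpace ℝ (Fin 2) → ENNReal} (hg : Measurable g) :
    ∫⁻ x, g x = ∫⁻ θ in Set.Ioo (-π) π, ∫⁻ ρ in Set.Ioi (0 : ℝ), ENNReal.ofReal ρ * g (hsP ρ θ) := by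
  have hm : Measurable fun z : ℝ × ℝ => hsV z.1 z.2 := by
    unfold hsV; fun_prop
  have h1 : ∫⁻ x, g x = ∫⁻ z : ℝ × ℝ, g (hsV z.1 z.2) := by
    rw [← (PiLp.volume_preserving_toLp (Fin 2)).lintegral_comp hg]
    refine Eq.trans ?_ ((volume_preserving_finTwoArrow ℝ).lintegral_comp (hg.comp hm))
    refine lintegral_congr fun x => ?_
    change _ = g (hsV (x 0) (x 1))
    rw [hsV_eq]
    congr 1
    ext i; fin_cases i <;> simp
  rw [h1, ← lintegral_comp_polarCoord_symm]
  have ht : polarCoord.target = Set.Ioi (0 : ℝ) ×ˢ Set.Ioo (-π) π := rfl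
  rw [ht, Measure.volume_eq_prod, setLIntegral_prod_symm]
  · rfl
  · apply Measurable.aemeasurable
    have : Measurable fun p : ℝ × ℝ => ENNReal.ofReal p.1 * g (hsP p.1 p.2) :=
      (by fun_prop : Measurable fun p : ℝ × ℝ => ENNReal.ofReal p.1).mul (hg.comp hsP_cont.measurable)
    exact this

/-- gradient splitting -/
theorem hs_grad (L : EuclideanSpace ℝ (Fin 2) →L[ℝ] ℝ) (θ a b : ℝ)
    (h : a ^ 2 + b ^ 2 ≤ 1) :
    a * |L (hsV (-sin θ) (cos θ))| + b * |L (hsV (cos θ) (sin θ))| ≤ ‖L‖ := by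
  obtain ⟨σ, hσ, e1⟩ : ∃ σ : ℝ, σ ^ 2 = 1 ∧ |L (hsV (-sin θ) (cos θ))| = σ * L (hsV (-sin θ) (cos θ)) := by
    rcases abs_choice (L (hsV (-sin θ) (cos θ))) with h | h
    · exact ⟨1, by norm_num, by rw [h]; ring⟩
    · exact ⟨-1, by norm_num, by rw [h]; ring⟩
  obtain ⟨τ, hτ, e2⟩ : ∃ σ : ℝ, σ ^ 2 = 1 ∧ |L (hsV (cos θ) (sin θ))| = σ * L (hsV (cos θ) (sin θ)) := by
    rcases abs_choice (L (hsV (cos θ) (sin θ))) with h | h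
    · exact ⟨1, by norm_num, by rw [h]; ring⟩
    · exact ⟨-1, by norm_num, by rw [h]; ring⟩
  rw [e1, e2]
  set v := (a * σ) • hsV (-sin θ) (cos θ) + (b * τ) • hsV (cos θ) (sin θ) with hv
  have hLv : a * (σ * L (hsV (-sin θ) (cos θ))) + b * (τ * L (hsV (cos θ) (sin θ))) = L v := by
    rw [hv, map_add, map_smul, map_smul, smul_eq_mul, smul_eq_mul]; ring
  have hve : v = hsV (a * σ * (-sin θ) + b * τ * cos θ) (a * σ * cos θ + b * τ * sin θ) := by
    rw [hv]; simp only [hsV]; module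
  have hvn : ‖v‖ ≤ 1 := by
    rw [hve, hsV_norm, Real.sqrt_le_one]
    refine le_trans (le_of_eq ?_) h
    linear_combination ((a * σ) ^ 2 + (b * τ) ^ 2) * (cos_sq_add_sin_sq θ) + a ^ 2 * hσ + b ^ 2 * hτ
  rw [hLv]
  calc L v ≤ ‖L v‖ := le_abs_self _
    _ ≤ ‖L‖ * ‖v‖ := L.le_opNorm v
    _ ≤ ‖L‖ * 1 := by gcongr
    _ = ‖L‖ := mul_one _


set_option maxHeartbeats 1600000 in
theorem hs_slice {α a b a' M : ℝ} (h0 : 0 < α) (h1 : α < 1) (ha : 0 ≤ a) (hab : a ≤ b) (hb : 0 < b)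
    (hbM : b ≤ M) (haa : a ≤ a') {w : EuclideanSpace ℝ (Fin 2) → ℝ} (hw : ContDiff ℝ 1 w)
    (hw0 : ∀ x, 0 ≤ w x) (hM : ∀ x, M ≤ ‖x‖ → w x = 0) (hin : ∀ x, ‖x‖ = a → w x = 1)
    (hcirc : ∀ ρ ∈ Set.Ioo a' b, ∃ x y, ‖x‖ = ρ ∧ ‖y‖ = ρ ∧ w x = 1 ∧ w y = 0)
    {Z : Set (EuclideanSpace ℝ (Fin 2))} (hZm : MeasurableSet Z) (hZ : ∀ x ∈ Z, w x = 1)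
    (hZb : Z ⊆ Metric.closedBall 0 b) (hZ0 : 0 < volume Z) :
    ENNReal.ofReal (2 * π * ((volume Z).toReal / π) ^ (α / 2)) ≤
      (∫⁻ x, ENNReal.ofReal (‖fderiv ℝ w x‖ * ‖x‖ ^ (α - 1))) +
        ENNReal.ofReal (2 / α * (a' ^ α - a ^ α)) := by
  obtain ⟨μ, c, hμ, hc, ea, eb, hout, hins⟩ := hs_chord h0 h1 ha hab hb
  have hpi := pi_pos
  set fr : ℝ → ℝ → ℝ := fun ρ θ => fderiv ℝ w (hsP ρ θ) (hsV (cos θ) (sin θ)) with hfr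
  set ft : ℝ → ℝ → ℝ := fun ρ θ => fderiv ℝ w (hsP ρ θ) (ρ • hsV (-sin θ) (cos θ)) with hft
  have hwd : Differentiable ℝ w := hw.differentiable (by norm_num)
  have hwf : Continuous (fderiv ℝ w) := hw.continuous_fderiv (by norm_num)
  have cP : Continuous fun z : ℝ × ℝ => hsP z.1 z.2 := hsP_cont
  have cV1 : Continuous fun z : ℝ × ℝ => hsV (cos z.2) (sin z.2) := by unfold hsV; fun_prop
  have cV2 : Continuous fun z : ℝ × ℝ => z.1 • hsV (-sin z.2) (cos z.2) := by unfold hsV; fun_prop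
  have cfr : Continuous fun z : ℝ × ℝ => fr z.1 z.2 := (hwf.comp cP).clm_apply cV1
  have cft : Continuous fun z : ℝ × ℝ => ft z.1 z.2 := (hwf.comp cP).clm_apply cV2
  have cw : Continuous fun z : ℝ × ℝ => w (hsP z.1 z.2) := hw.continuous.comp cP
  have dr : ∀ ρ θ, HasDerivAt (fun r => w (hsP r θ)) (fr ρ θ) ρ := fun ρ θ =>
    (hwd (hsP ρ θ)).hasFDerivAt.comp_hasDerivAt ρ (hsP_deriv_r ρ θ)
  have dt : ∀ ρ θ, HasDerivAt (fun t => w (hsP ρ t)) (ft ρ θ) θ := fun ρ θ =>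
    (hwd (hsP ρ θ)).hasFDerivAt.comp_hasDerivAt θ (hsP_deriv_t ρ θ)
  set B : ℝ → ℝ := fun ρ => (c + μ * ρ ^ 2) / ρ ^ α with hB
  set K : ℝ → ENNReal := fun ρ => ENNReal.ofReal (ρ ^ (α - 1) * √(1 - (B ρ) ^ 2)) with hK
  have mK : Measurable K := by simp only [hK, hB]; fun_prop
  set X : ℝ → ℝ → ENNReal := fun θ ρ => K ρ * ENNReal.ofReal |ft ρ θ| with hX
  have mX : Measurable fun z : ℝ × ℝ => X z.1 z.2 := by
    have : Measurable fun z : ℝ × ℝ => ENNReal.ofReal |ft z.2 z.1| :=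
      ((cft.comp continuous_swap).abs.measurable).ennreal_ofReal
    exact (mK.comp measurable_snd).mul this
  set W : ℝ → ℝ → ENNReal := fun θ ρ => ENNReal.ofReal (2 * μ * ρ * w (hsP ρ θ)) with hW
  have mW : Measurable fun z : ℝ × ℝ => W z.1 z.2 := by
    have : Continuous fun z : ℝ × ℝ => 2 * μ * z.2 * w (hsP z.2 z.1) :=
      (by fun_prop : Continuous fun z : ℝ × ℝ => 2 * μ * z.2).mul (cw.comp continuous_swap)
    exact this.measurable.ennreal_ofReal
  set S := Set.Ioo (-π) π with hS
  have vS : volume S = ENNReal.ofReal (2 * π) := by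
    rw [hS, Real.volume_Ioo]; congr 1; ring
  have hE1 : ∀ θ, (∫⁻ ρ in Set.Ioo a b, X θ ρ) +
      (ENNReal.ofReal (a ^ α) + ∫⁻ ρ in Set.Ioo a b, W θ ρ) ≤
      ∫⁻ ρ in Set.Ioi (0 : ℝ), ENNReal.ofReal ρ *
        ENNReal.ofReal (‖fderiv ℝ w (hsP ρ θ)‖ * ‖hsP ρ θ‖ ^ (α - 1)) := by
    intro θ
    have hrad := hs_radial h0 ha hab hbM hμ hc ea eb (f := fun r => w (hsP r θ)) (f' := fun r => fr r θ)
      (fun ρ => dr ρ θ) (cfr.comp (by fun_prop : Continuous fun r : ℝ => (r, θ))) (fun ρ => hw0 _)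
      (hin _ (by rw [hsP_norm, abs_of_nonneg ha])) (hM _ (by rw [hsP_norm]; exact le_abs_self _))
    refine (add_le_add le_rfl hrad).trans ?_
    have mXθ : Measurable (X θ) := mX.comp (by fun_prop : Measurable fun r : ℝ => (θ, r))
    set Dm : ℝ → ENNReal := fun ρ => ENNReal.ofReal ρ *
        ENNReal.ofReal (‖fderiv ℝ w (hsP ρ θ)‖ * ‖hsP ρ θ‖ ^ (α - 1)) with hDm
    have hDe : ∀ ρ, 0 < ρ → Dm ρ = ENNReal.ofReal (ρ ^ α * ‖fderiv ℝ w (hsP ρ θ)‖) := by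
      intro ρ hρ
      simp only [hDm]
      rw [← ENNReal.ofReal_mul hρ.le, hsP_norm, abs_of_pos hρ, rpow_sub_one hρ.ne']
      congr 1
      field_simp
    rw [← add_assoc, ← lintegral_add_left mXθ]
    have t1 : ∫⁻ ρ in Set.Ioo a b, (X θ ρ + ENNReal.ofReal ((c + μ * ρ ^ 2) * |fr ρ θ|)) ≤
        ∫⁻ ρ in Set.Ioo a b, Dm ρ := by
      refine setLIntegral_mono' measurableSet_Ioo ?_
      intro ρ hρ
      have hρ0 : 0 < ρ := ha.trans_lt hρ.1
      have hP : 0 < ρ ^ α := by positivity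
      have hB0 : 0 ≤ B ρ := by simp only [hB]; positivity
      have hB1 : B ρ ≤ 1 := by simp only [hB]; rw [div_le_one hP]; exact hins ρ hρ
      have hBe : c + μ * ρ ^ 2 = ρ ^ α * B ρ := by simp only [hB]; field_simp
      have hft' : |ft ρ θ| = ρ * |fderiv ℝ w (hsP ρ θ) (hsV (-sin θ) (cos θ))| := by
        simp only [hft]; rw [map_smul, smul_eq_mul, abs_mul, abs_of_pos hρ0]
      rw [hDe ρ hρ0, hBe]
      simp only [hX, hK]
      rw [← ENNReal.ofReal_mul (by positivity), ← ENNReal.ofReal_add (by positivity) (by positivity), hft',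
        rpow_sub_one hρ0.ne']
      apply ENNReal.ofReal_le_ofReal
      have := hs_grad (fderiv ℝ w (hsP ρ θ)) θ (√(1 - B ρ ^ 2)) (B ρ)
        (by rw [sq_sqrt (by nlinarith)]; linarith)
      have := mul_le_mul_of_nonneg_left this hP.le
      refine le_trans (le_of_eq ?_) this
      simp only [hfr]
      field_simp
    have t2 : ∫⁻ ρ in Set.Ioi b, ENNReal.ofReal (ρ ^ α * |fr ρ θ|) ≤ ∫⁻ ρ in Set.Ioi b, Dm ρ := by
      refine setLIntegral_mono' measurableSet_Ioi ?_
      intro ρ hρ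
      have hρ0 : 0 < ρ := hb.trans hρ
      rw [hDe ρ hρ0]
      apply ENNReal.ofReal_le_ofReal
      have := hs_grad (fderiv ℝ w (hsP ρ θ)) θ 0 1 (by norm_num)
      simp only [zero_mul, zero_add, one_mul] at this
      gcongr
    refine (add_le_add t1 t2).trans ?_
    rw [← lintegral_union measurableSet_Ioi]
    · apply lintegral_mono_set
      rintro x (hx | hx)
      · exact ha.trans_lt hx.1
      · exact hb.trans hx
    · rw [Set.disjoint_left]; intro x hx hx'; exact absurd hx.2 (not_lt.2 (le_of_lt hx'))
  have hE : (∫⁻ θ in S, ∫⁻ ρ in Set.Ioo a b, X θ ρ) +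
      (ENNReal.ofReal (a ^ α) * ENNReal.ofReal (2 * π) + ∫⁻ θ in S, ∫⁻ ρ in Set.Ioo a b, W θ ρ) ≤
      ∫⁻ x, ENNReal.ofReal (‖fderiv ℝ w x‖ * ‖x‖ ^ (α - 1)) := by
    rw [hs_polar (by
      have : Measurable fun x => ‖fderiv ℝ w x‖ := hwf.norm.measurable
      fun_prop)]
    refine le_trans (le_of_eq ?_) (lintegral_mono fun θ => hE1 θ)
    rw [lintegral_add_left mX.lintegral_prod_right', lintegral_add_left measurable_const,
      setLIntegral_const, vS]
  have hXlow : ENNReal.ofReal 2 * ∫⁻ ρ in Set.Ioo a' b, K ρ ≤ ∫⁻ θ in S, ∫⁻ ρ in Set.Ioo a b, X θ ρ := by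
    rw [lintegral_lintegral_swap mX.aemeasurable, ← lintegral_const_mul _ mK]
    refine le_trans (setLIntegral_mono' measurableSet_Ioo ?_)
      (lintegral_mono_set (Set.Ioo_subset_Ioo_left haa))
    intro ρ hρ
    obtain ⟨x, y, hx, hy, wx, wy⟩ := hcirc ρ hρ
    obtain ⟨θ₁, h1⟩ := hsP_surj x
    obtain ⟨θ₂, h2⟩ := hsP_surj y
    rw [hx] at h1
    rw [hy] at h2
    have cc : Continuous fun t => ft ρ t := cft.comp (by fun_prop : Continuous fun t : ℝ => (ρ, t))
    have := hs_angular (f := fun t => w (hsP ρ t)) (f' := fun t => ft ρ t) (dt ρ) cc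
      (fun t => by simp only [hsP_periodic ρ t]) (x₁ := θ₁) (x₂ := θ₂) (by rw [← h1]; exact wx)
      (by rw [← h2]; exact wy)
    simp only [hX]
    rw [lintegral_const_mul _ cc.abs.measurable.ennreal_ofReal, mul_comm]
    gcongr
  have hKtot : ∫⁻ ρ in Set.Ioi (0 : ℝ), K ρ ≤ (∫⁻ ρ in Set.Ioo a' b, K ρ) +
      ENNReal.ofReal (1 / α * (a' ^ α - a ^ α)) := by
    have hK0 : ∀ ρ, 0 < ρ → ρ ∉ Set.Ioo a b → K ρ = 0 := by
      intro ρ hρ hn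
      have : 1 ≤ B ρ := by
        simp only [hB]; rw [one_le_div (by positivity)]; exact hout ρ hρ.le hn
      simp only [hK]
      rw [sqrt_eq_zero_of_nonpos (by nlinarith)]; simp
    have hsub : Set.Ioi (0 : ℝ) ⊆ (Set.Ioo a' b ∪ Set.Ioc a a') ∪ (Set.Ioi 0 \ Set.Ioo a b) := by
      intro x hx
      by_cases hxx : x ∈ Set.Ioo a b
      · rcases le_or_gt x a' with h | h
        · exact Or.inl (Or.inr ⟨hxx.1, h⟩)
        · exact Or.inl (Or.inl ⟨h, hxx.2⟩)
      · exact Or.inr ⟨hx, hxx⟩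
    have hz : ∫⁻ ρ in (Set.Ioi 0 \ Set.Ioo a b), K ρ = 0 := by
      rw [setLIntegral_congr_fun (g := fun _ => 0) (measurableSet_Ioi.diff measurableSet_Ioo)
        (fun ρ h => hK0 ρ h.1 h.2)]
      simp
    refine (lintegral_mono_set hsub).trans ((lintegral_union_le _ _ _).trans ?_)
    rw [hz, add_zero]
    refine (lintegral_union_le _ _ _).trans (add_le_add le_rfl ?_)
    rw [← setLIntegral_congr Ioo_ae_eq_Ioc]
    have hF := hs_ftc_lintegral haa (F := fun ρ => ρ ^ α / α) (F' := fun ρ => ρ ^ (α - 1))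
      ((continuous_id.rpow_const (fun _ => Or.inr h0.le)).div_const α).continuousOn
      (fun x hx => ((hasDerivAt_rpow_const (p := α) (Or.inl (ha.trans_lt hx.1).ne')).div_const α).congr_deriv
        (by field_simp))
      (fun x hx => rpow_nonneg (ha.trans hx.1.le) _)
    rw [show 1 / α * (a' ^ α - a ^ α) = a' ^ α / α - a ^ α / α by ring, ← hF]
    refine setLIntegral_mono' measurableSet_Ioo ?_
    intro ρ hρ
    apply ENNReal.ofReal_le_ofReal
    have h1 : 0 ≤ ρ ^ (α - 1) := rpow_nonneg (ha.trans hρ.1.le) _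
    have h2 : √(1 - B ρ ^ 2) ≤ 1 := Real.sqrt_le_one.2 (by nlinarith)
    nlinarith
  have hZtop : volume Z ≠ ⊤ := ((measure_mono hZb).trans_lt measure_closedBall_lt_top).ne
  set V := (volume Z).toReal with hV
  have hV0 : 0 < V := ENNReal.toReal_pos hZ0.ne' hZtop
  have hWlow : ENNReal.ofReal (2 * μ * (V - π * a ^ 2)) ≤
      ∫⁻ θ in S, ∫⁻ ρ in Set.Ioo a b, W θ ρ := by
    set N := {x : EuclideanSpace ℝ (Fin 2) | a < ‖x‖ ∧ ‖x‖ < b} with hN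
    have mN : MeasurableSet N :=
      (measurableSet_lt measurable_const measurable_norm).inter
        (measurableSet_lt measurable_norm measurable_const)
    have hsub : Z ⊆ (Z ∩ N ∪ Metric.closedBall 0 a) ∪ Metric.sphere 0 b := by
      intro x hx
      have hxb := hZb hx
      rw [mem_closedBall_zero_iff] at hxb
      rcases le_or_gt ‖x‖ a with h | h
      · exact Or.inl (Or.inr (mem_closedBall_zero_iff.2 h))
      · rcases hxb.eq_or_lt with h' | h'
        · exact Or.inr (mem_sphere_zero_iff_norm.2 h')
        · exact Or.inl (Or.inl ⟨hx, h, h'⟩)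
    have hvol : volume Z ≤ volume (Z ∩ N) + ENNReal.ofReal (π * a ^ 2) := by
      refine (measure_mono hsub).trans ((measure_union_le _ _).trans ?_)
      rw [Measure.addHaar_sphere, add_zero]
      refine (measure_union_le _ _).trans (add_le_add le_rfl (le_of_eq ?_))
      rw [EuclideanSpace.volume_closedBall_fin_two, ← ENNReal.ofReal_pow ha,
        ← ENNReal.ofReal_mul (by positivity), mul_comm]
    have hlow : ENNReal.ofReal (V - π * a ^ 2) ≤ volume (Z ∩ N) := by
      rw [ENNReal.ofReal_sub _ (by positivity), hV, ENNReal.ofReal_toReal hZtop]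
      exact tsub_le_iff_right.2 hvol
    rw [ENNReal.ofReal_mul (by positivity)]
    refine (mul_le_mul_right hlow _).trans ?_
    have mI : Measurable ((Z ∩ N).indicator (1 : EuclideanSpace ℝ (Fin 2) → ENNReal)) :=
      measurable_one.indicator (hZm.inter mN)
    rw [← lintegral_indicator_one (hZm.inter mN), hs_polar mI,
      ← lintegral_const_mul' _ _ ENNReal.ofReal_ne_top]
    refine lintegral_mono fun θ => ?_
    simp only
    rw [← lintegral_const_mul' _ _ ENNReal.ofReal_ne_top, ← lintegral_indicator measurableSet_Ioo]
    refine le_trans (setLIntegral_mono' measurableSet_Ioi ?_) (setLIntegral_le_lintegral (Set.Ioi 0) _)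
    intro ρ hρ
    by_cases hin : hsP ρ θ ∈ Z ∩ N
    · have h2 := hin.2
      simp only [hN, Set.mem_ofPred_eq, hsP_norm, abs_of_pos (show 0 < ρ from hρ)] at h2
      rw [Set.indicator_of_mem hin, Set.indicator_of_mem (show ρ ∈ Set.Ioo a b from h2)]
      simp only [hW, hZ _ hin.1, Pi.one_apply, mul_one]
      exact le_of_eq (ENNReal.ofReal_mul (by positivity)).symm
    · rw [Set.indicator_of_notMem hin]; simp
  set x := √(V / π) with hx
  have hx0 : 0 < x := sqrt_pos.2 (by positivity)
  have hx2 : π * x ^ 2 = V := by rw [hx, sq_sqrt (by positivity)]; field_simp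
  have hxα : (V / π) ^ (α / 2) = x ^ α := by
    rw [hx, sqrt_eq_rpow, ← rpow_mul (by positivity)]; congr 1; ring
  have hJ := hs_J h0 (by linarith) hμ hc hx0
  have hJ2 := hJ.trans hKtot
  have hmul := mul_le_mul_right hJ2 (ENNReal.ofReal 2)
  rw [hxα]
  calc ENNReal.ofReal (2 * π * x ^ α)
      = ENNReal.ofReal (2 * (π * (x ^ α - μ * x ^ 2 - c)) + (a ^ α * (2 * π) + 2 * μ * (V - π * a ^ 2))) := by
        congr 1
        rw [← hx2]
        linear_combination 2 * π * ea
    _ ≤ ENNReal.ofReal 2 * ENNReal.ofReal (π * (x ^ α - μ * x ^ 2 - c)) +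
        (ENNReal.ofReal (a ^ α) * ENNReal.ofReal (2 * π) + ENNReal.ofReal (2 * μ * (V - π * a ^ 2))) := by
        rw [← ENNReal.ofReal_mul (by norm_num), ← ENNReal.ofReal_mul (by positivity)]
        exact ENNReal.ofReal_add_le.trans (add_le_add le_rfl ENNReal.ofReal_add_le)
    _ ≤ ENNReal.ofReal 2 * ((∫⁻ ρ in Set.Ioo a' b, K ρ) + ENNReal.ofReal (1 / α * (a' ^ α - a ^ α))) +
        (ENNReal.ofReal (a ^ α) * ENNReal.ofReal (2 * π) + ∫⁻ θ in S, ∫⁻ ρ in Set.Ioo a b, W θ ρ) :=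
        add_le_add hmul (add_le_add le_rfl hWlow)
    _ = (ENNReal.ofReal 2 * (∫⁻ ρ in Set.Ioo a' b, K ρ) +
        (ENNReal.ofReal (a ^ α) * ENNReal.ofReal (2 * π) + ∫⁻ θ in S, ∫⁻ ρ in Set.Ioo a b, W θ ρ)) +
        ENNReal.ofReal (2 / α * (a' ^ α - a ^ α)) := by
        rw [mul_add, ← ENNReal.ofReal_mul (by norm_num),
          show 2 * (1 / α * (a' ^ α - a ^ α)) = 2 / α * (a' ^ α - a ^ α) by ring]
        ring
    _ ≤ _ := add_le_add ((add_le_add hXlow le_rfl).trans hE) le_rfl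


/-- The radii in `[0, M]` whose circle is inside the superlevel set. -/
def hsIn (u : EuclideanSpace ℝ (Fin 2) → ℝ) (M t : ℝ) : Set ℝ :=
  {ρ | ρ ∈ Set.Icc 0 M ∧ (ρ = 0 ∨ ∀ θ, t ≤ u (hsP ρ θ))}

noncomputable def hsR (u : EuclideanSpace ℝ (Fin 2) → ℝ) (M t : ℝ) : ℝ := sSup (hsIn u M t)

theorem hsIn_bdd (u : EuclideanSpace ℝ (Fin 2) → ℝ) (M t : ℝ) : BddAbove (hsIn u M t) :=
  ⟨M, fun _ h => h.1.2⟩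

theorem hsIn_zero (u : EuclideanSpace ℝ (Fin 2) → ℝ) {M : ℝ} (hM : 0 ≤ M) (t : ℝ) :
    (0 : ℝ) ∈ hsIn u M t := ⟨⟨le_rfl, hM⟩, Or.inl rfl⟩

theorem hsR_nonneg (u : EuclideanSpace ℝ (Fin 2) → ℝ) {M : ℝ} (hM : 0 ≤ M) (t : ℝ) : 0 ≤ hsR u M t :=
  le_csSup (hsIn_bdd u M t) (hsIn_zero u hM t)

theorem hsR_le (u : EuclideanSpace ℝ (Fin 2) → ℝ) {M : ℝ} (hM : 0 ≤ M) (t : ℝ) : hsR u M t ≤ M :=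
  csSup_le ⟨0, hsIn_zero u hM t⟩ fun _ h => h.1.2

theorem hsR_anti (u : EuclideanSpace ℝ (Fin 2) → ℝ) {M s t : ℝ} (hM : 0 ≤ M) (hst : s ≤ t) :
    hsR u M t ≤ hsR u M s :=
  csSup_le_csSup (hsIn_bdd u M s) ⟨0, hsIn_zero u hM t⟩
    fun _ h => ⟨h.1, h.2.imp id fun h θ => hst.trans (h θ)⟩

theorem hsR_mem {u : EuclideanSpace ℝ (Fin 2) → ℝ} (hu : Continuous u) {M : ℝ} (hM : 0 ≤ M) (t : ℝ) :
    hsR u M t ∈ hsIn u M t := by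
  have hcl : IsClosed {ρ : ℝ | ρ = 0 ∨ ∀ θ, t ≤ u (hsP ρ θ)} := by
    refine IsClosed.union isClosed_singleton ?_
    have : {ρ : ℝ | ∀ θ, t ≤ u (hsP ρ θ)} = ⋂ θ, {ρ : ℝ | t ≤ u (hsP ρ θ)} := by
      ext; simp
    change IsClosed {ρ : ℝ | ∀ θ, t ≤ u (hsP ρ θ)}
    rw [this]
    refine isClosed_iInter fun θ => ?_
    exact isClosed_le continuous_const
      (hu.comp (hsP_cont.comp (by fun_prop : Continuous fun ρ : ℝ => (ρ, θ))))
  have hc : IsCompact (hsIn u M t) := isCompact_Icc.inter_right hcl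
  exact hc.sSup_mem ⟨0, hsIn_zero u hM t⟩

theorem hs_level {α M s t : ℝ} (h0 : 0 < α) (h1 : α < 1) (hM : 0 < M) (hs : 0 ≤ s) (hst : s < t)
    {u : EuclideanSpace ℝ (Fin 2) → ℝ} (hu : ContDiff ℝ 1 u)
    (huM : ∀ x, M ≤ ‖x‖ → u x = 0) (hmax : ∀ x, u x ≤ u 0)
    (hconn : ∀ t', 0 < t' → t' < u 0 → IsPreconnected {x | t' < u x})
    {η : ℝ → ℝ} (hη : ContDiff ℝ 1 η) (hη0 : ∀ y, 0 ≤ η y) (hηs : ∀ y, y ≤ s → η y = 0)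
    (hηt : ∀ y, t ≤ y → η y = 1) :
    ENNReal.ofReal (2 * π * ((volume {x | t ≤ u x}).toReal / π) ^ (α / 2)) ≤
      (∫⁻ x, ENNReal.ofReal (‖fderiv ℝ (η ∘ u) x‖ * ‖x‖ ^ (α - 1))) +
        ENNReal.ofReal (2 / α * (hsR u M s ^ α - hsR u M t ^ α)) := by
  set Z := {x | t ≤ u x} with hZ
  have ht : 0 < t := hs.trans_lt hst
  rcases eq_or_ne (volume Z) 0 with hz | hz
  · rw [hz]
    simp [zero_rpow (by linarith : α / 2 ≠ 0)]
  have hne : Z.Nonempty := nonempty_of_measure_ne_zero hz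
  have htu : t ≤ u 0 := by
    obtain ⟨x, hx⟩ := hne
    exact le_trans hx (hmax x)
  have hZM : ∀ x ∈ Z, ‖x‖ ≤ M := by
    intro x hx
    by_contra h
    have := huM x (not_le.1 h).le
    have hx' : t ≤ u x := hx
    linarith
  set b := sSup (norm '' Z) with hb
  have hbdd : BddAbove (norm '' Z) := ⟨M, by rintro _ ⟨x, hx, rfl⟩; exact hZM x hx⟩
  have hle : ∀ x ∈ Z, ‖x‖ ≤ b := fun x hx => le_csSup hbdd ⟨x, hx, rfl⟩
  have hb0 : 0 < b := by
    by_contra hcon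
    apply hz
    refine measure_mono_null (t := {0}) ?_ (measure_singleton 0)
    intro x hx
    have := hle x hx
    exact norm_le_zero_iff.1 (this.trans (not_lt.1 hcon))
  have hbM : b ≤ M := csSup_le (hne.image _) (by rintro _ ⟨x, hx, rfl⟩; exact hZM x hx)
  obtain ⟨⟨ha0, haM⟩, haor⟩ := hsR_mem hu.continuous hM.le t
  set a := hsR u M t with ha
  have hin : ∀ x, ‖x‖ = a → t ≤ u x := by
    intro x hx
    rcases haor with h | h
    · rw [h, norm_eq_zero] at hx; rw [hx]; exact htu
    · obtain ⟨θ, hθ⟩ := hsP_surj x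
      rw [hθ, hx]; exact h θ
  have hab : a ≤ b := by
    have := hle (hsP a 0) (hin _ (by rw [hsP_norm, abs_of_nonneg ha0]))
    rwa [hsP_norm, abs_of_nonneg ha0] at this
  refine hs_slice (b := b) h0 h1 ha0 hab hb0 hbM (hsR_anti u hM.le hst.le) (hη.comp hu) (fun x => hη0 _)
    (fun x hx => hηs _ ?_) (fun x hx => hηt _ (hin x hx)) ?_
    (measurableSet_le measurable_const hu.continuous.measurable) (fun x hx => hηt _ hx) ?_
    (pos_iff_ne_zero.2 hz)
  · rw [huM x hx]; exact hs
  · intro ρ hρ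
    have hρ0 : 0 < ρ := (hsR_nonneg u hM.le s).trans_lt hρ.1
    obtain ⟨_, ⟨y, hy, rfl⟩, hyρ⟩ := exists_lt_of_lt_csSup (hne.image _) hρ.2
    have hex : ∀ t', 0 < t' → t' < t → ∃ z, ‖z‖ = ρ ∧ t' < u z := by
      intro t' h0' ht'
      have hpre := hconn t' h0' (ht'.trans_le htu)
      have hy' : y ∈ {x | t' < u x} := lt_of_lt_of_le ht' hy
      have := hpre.intermediate_value (show (0 : EuclideanSpace ℝ (Fin 2)) ∈ {x | t' < u x} from
        ht'.trans_le htu) hy' continuous_norm.continuousOn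
      obtain ⟨z, hz, hzρ⟩ := this (show ρ ∈ Set.Icc ‖(0 : EuclideanSpace ℝ (Fin 2))‖ ‖y‖ from
        ⟨by rw [norm_zero]; exact hρ0.le, hyρ.le⟩)
      exact ⟨z, hzρ, hz⟩
    obtain ⟨z₀, hz₀, -⟩ := hex (t / 2) (by linarith) (by linarith)
    obtain ⟨z, hzs, hzmax⟩ := (isCompact_sphere (0 : EuclideanSpace ℝ (Fin 2)) ρ).exists_isMaxOn
      ⟨z₀, mem_sphere_zero_iff_norm.2 hz₀⟩ hu.continuous.continuousOn
    have hzt : t ≤ u z := by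
      by_contra hcon
      push Not at hcon
      obtain ⟨z', hz', hlt⟩ := hex (max (u z) (t / 2)) (lt_max_of_lt_right (by linarith))
        (max_lt hcon (by linarith))
      have : u z' ≤ u z := hzmax (mem_sphere_zero_iff_norm.2 hz')
      have := le_max_left (u z) (t / 2)
      linarith
    have hnot : ρ ∉ hsIn u M s := fun h => absurd (le_csSup (hsIn_bdd u M s) h) (not_le.2 hρ.1)
    have : ∃ θ, u (hsP ρ θ) < s := by
      by_contra hcon
      push Not at hcon
      exact hnot ⟨⟨hρ0.le, hρ.2.le.trans hbM⟩, Or.inr hcon⟩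
    obtain ⟨θ, hθ⟩ := this
    exact ⟨z, hsP ρ θ, mem_sphere_zero_iff_norm.1 hzs, by rw [hsP_norm, abs_of_pos hρ0],
      hηt _ hzt, hηs _ hθ.le⟩
  · intro x hx
    exact mem_closedBall_zero_iff.2 (hle x hx)


theorem hs_q_deriv (y : ℝ) : HasDerivAt (fun y : ℝ => (max 0 y) ^ 2 / 2) (max 0 y) y := by
  have hne : ∀ y : ℝ, y ≠ 0 → HasDerivAt (fun y : ℝ => (max 0 y) ^ 2 / 2) (max 0 y) y := by
    intro y hy
    rcases lt_or_gt_of_ne hy with h | h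
    · rw [max_eq_left h.le]
      refine (hasDerivAt_const y (0 : ℝ)).congr_of_eventuallyEq ?_
      filter_upwards [Iio_mem_nhds h] with z hz
      rw [max_eq_left (le_of_lt hz)]; norm_num
    · rw [max_eq_right h.le]
      refine HasDerivAt.congr_of_eventuallyEq (f := fun z => z ^ 2 / 2) ?_ ?_
      · refine ((hasDerivAt_pow 2 y).div_const 2).congr_deriv ?_
        norm_num
      · filter_upwards [Ioi_mem_nhds h] with z hz
        rw [max_eq_right (le_of_lt hz)]
  rcases eq_or_ne y 0 with rfl | hy
  · exact hasDerivAt_of_hasDerivAt_of_ne (g := fun y => max 0 y) (fun y hy => hne y hy)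
      (Continuous.continuousAt (by fun_prop)) (Continuous.continuousAt (by fun_prop))
  · exact hne y hy

/-- hat function -/
noncomputable def hsL (h : ℝ) (k : ℕ) (y : ℝ) : ℝ :=
  max 0 (y / h - k) - 2 * max 0 (y / h - k - 1) + max 0 (y / h - k - 2)

noncomputable def hsEta (h : ℝ) (k : ℕ) (y : ℝ) : ℝ :=
  (max 0 (y / h - k)) ^ 2 / 2 - 2 * ((max 0 (y / h - k - 1)) ^ 2 / 2) + (max 0 (y / h - k - 2)) ^ 2 / 2

theorem hsEta_deriv (h : ℝ) (k : ℕ) (y : ℝ) : HasDerivAt (hsEta h k) (hsL h k y / h) y := by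
  have e : ∀ d : ℝ, HasDerivAt (fun y : ℝ => (max 0 (y / h - d)) ^ 2 / 2) (max 0 (y / h - d) * (1 / h)) y := by
    intro d
    have := (hs_q_deriv (y / h - d)).comp y (((hasDerivAt_id y).div_const h).sub_const d)
    exact this
  have e0 := e k
  have e1 := e (k + 1)
  have e2 := e (k + 2)
  simp only [← sub_sub] at e1 e2
  unfold hsEta
  refine ((e0.sub (e1.const_mul 2)).add e2).congr_deriv ?_
  unfold hsL; ring

theorem hsL_nonneg (h : ℝ) (k : ℕ) (y : ℝ) : 0 ≤ hsL h k y := by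
  unfold hsL
  generalize y / h - k = z
  rcases le_total 0 z with h1 | h1 <;> rcases le_total 0 (z - 1) with h2 | h2 <;>
    rcases le_total 0 (z - 2) with h3 | h3 <;> simp only [max_eq_left, max_eq_right, *] <;> linarith

theorem hsL_sum (h : ℝ) (N : ℕ) (y : ℝ) : ∑ k ∈ Finset.range N, hsL h k y ≤ 1 := by
  have e : ∑ k ∈ Finset.range N, hsL h k y = (max 0 (y / h) - max 0 (y / h - 1)) -
      (max 0 (y / h - N) - max 0 (y / h - N - 1)) := by
    induction N with
    | zero => simp
    | succ n ih =>
      rw [Finset.sum_range_succ, ih, hsL]; push_cast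
      rw [show y / h - (n + 1 : ℝ) = y / h - n - 1 by ring, show y / h - n - 1 - 1 = y / h - n - 2 by ring]
      ring
  rw [e]
  generalize y / h = z
  have a : max 0 z - max 0 (z - 1) ≤ 1 := by
    rcases le_total 0 z with h1 | h1 <;> rcases le_total 0 (z - 1) with h2 | h2 <;>
      simp only [max_eq_left, max_eq_right, *] <;> linarith
  have b : max 0 (z - N - 1) ≤ max 0 (z - N) := max_le_max le_rfl (by linarith)
  linarith

theorem hsEta_zero {h : ℝ} (hh : 0 < h) (k : ℕ) {y : ℝ} (hy : y ≤ k * h) : hsEta h k y = 0 := by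
  have : y / h ≤ k := (div_le_iff₀ hh).2 hy
  unfold hsEta
  rw [max_eq_left (by linarith), max_eq_left (by linarith), max_eq_left (by linarith)]; ring

theorem hsEta_one {h : ℝ} (hh : 0 < h) (k : ℕ) {y : ℝ} (hy : (k + 2 : ℝ) * h ≤ y) : hsEta h k y = 1 := by
  have : (k + 2 : ℝ) ≤ y / h := (le_div_iff₀ hh).2 hy
  unfold hsEta
  rw [max_eq_right (by linarith), max_eq_right (by linarith), max_eq_right (by linarith)]; ring

theorem hsL_cont (h : ℝ) (k : ℕ) : Continuous (hsL h k) := by unfold hsL; fun_prop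

theorem hsEta_contDiff (h : ℝ) (k : ℕ) : ContDiff ℝ 1 (hsEta h k) := by
  rw [contDiff_one_iff_deriv]
  refine ⟨fun y => (hsEta_deriv h k y).differentiableAt, ?_⟩
  have : deriv (hsEta h k) = fun y => hsL h k y / h := funext fun y => (hsEta_deriv h k y).deriv
  rw [this]
  exact (hsL_cont h k).div_const h

theorem hsEta_nonneg {h : ℝ} (hh : 0 < h) (k : ℕ) (y : ℝ) : 0 ≤ hsEta h k y := by
  rcases le_total y (k * h) with hy | hy
  · rw [hsEta_zero hh k hy]
  · have hm : Monotone (hsEta h k) := by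
      apply monotone_of_deriv_nonneg (fun y => (hsEta_deriv h k y).differentiableAt)
      intro y
      rw [(hsEta_deriv h k y).deriv]
      exact div_nonneg (hsL_nonneg h k y) hh.le
    rw [← hsEta_zero hh k (le_refl ((k : ℝ) * h))]
    exact hm hy

theorem hs_layer {h : ℝ} (hh : 0 < h) (N : ℕ) (y : ℝ) :
    min y ((N + 2 : ℝ) * h) ≤ 2 * h + ∑ k ∈ Finset.range N, if (k + 2 : ℝ) * h ≤ y then h else 0 := by
  induction N with
  | zero => simp
  | succ n ih =>
    rw [Finset.sum_range_succ]
    push_cast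
    split_ifs with hc
    · rw [min_eq_right hc] at ih
      have := min_le_right y ((n + 1 + 2 : ℝ) * h)
      nlinarith
    · push Not at hc
      rw [min_eq_left hc.le] at ih
      have := min_le_left y ((n + 1 + 2 : ℝ) * h)
      linarith

theorem hs_sum {α M h : ℝ} (h0 : 0 < α) (h1 : α < 1) (hM : 0 < M) (hh : 0 < h)
    {u : EuclideanSpace ℝ (Fin 2) → ℝ} (hu : ContDiff ℝ 1 u)
    (huM : ∀ x, M ≤ ‖x‖ → u x = 0) (hmax : ∀ x, u x ≤ u 0)
    (hconn : ∀ t', 0 < t' → t' < u 0 → IsPreconnected {x | t' < u x}) (N : ℕ) :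
    ∑ k ∈ Finset.range N, ENNReal.ofReal
        (h * (2 * π * ((volume {x | (k + 2 : ℝ) * h ≤ u x}).toReal / π) ^ (α / 2))) ≤
      (∫⁻ x, ENNReal.ofReal (‖fderiv ℝ u x‖ * ‖x‖ ^ (α - 1))) + ENNReal.ofReal (h * (4 / α * M ^ α)) := by
  have hlev : ∀ k : ℕ, ENNReal.ofReal
      (h * (2 * π * ((volume {x | (k + 2 : ℝ) * h ≤ u x}).toReal / π) ^ (α / 2))) ≤
      (∫⁻ x, ENNReal.ofReal (hsL h k (u x) * (‖fderiv ℝ u x‖ * ‖x‖ ^ (α - 1)))) +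
        ENNReal.ofReal (h * (2 / α * (hsR u M (k * h) ^ α - hsR u M ((k + 2 : ℝ) * h) ^ α))) := by
    intro k
    have := hs_level h0 h1 hM (s := k * h) (t := (k + 2 : ℝ) * h) (by positivity) (by nlinarith) hu huM hmax
      hconn (hsEta_contDiff h k) (hsEta_nonneg hh k) (fun y hy => hsEta_zero hh k hy)
      (fun y hy => hsEta_one hh k hy)
    rw [ENNReal.ofReal_mul hh.le, ENNReal.ofReal_mul (p := h) hh.le]
    refine (mul_le_mul_right this _).trans ?_
    rw [mul_add, ← lintegral_const_mul' _ _ ENNReal.ofReal_ne_top]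
    refine add_le_add (le_of_eq ?_) le_rfl
    refine lintegral_congr fun x => ?_
    rw [← ENNReal.ofReal_mul hh.le]
    congr 1
    have hd := ((hsEta_deriv h k (u x)).comp_hasFDerivAt x
      (hu.differentiable (by norm_num) x).hasFDerivAt).fderiv
    rw [hd, norm_smul, norm_of_nonneg (div_nonneg (hsL_nonneg h k _) hh.le)]
    field_simp
  have hmono : ∀ s t : ℝ, s ≤ t → 0 ≤ hsR u M s ^ α - hsR u M t ^ α := fun s t hst =>
    sub_nonneg.2 (rpow_le_rpow (hsR_nonneg u hM.le t) (hsR_anti u hM.le hst) h0.le)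
  refine (Finset.sum_le_sum fun k _ => hlev k).trans ?_
  rw [Finset.sum_add_distrib]
  refine add_le_add ?_ ?_
  · have hfd : Continuous (fderiv ℝ u) := hu.continuous_fderiv (by norm_num)
    rw [← lintegral_finsetSum]
    · refine lintegral_mono fun x => ?_
      simp only
      rw [← ENNReal.ofReal_sum_of_nonneg]
      · apply ENNReal.ofReal_le_ofReal
        rw [← Finset.sum_mul]
        exact mul_le_of_le_one_left (by positivity) (hsL_sum h N (u x))
      · intro k _
        exact mul_nonneg (hsL_nonneg _ _ _) (by positivity)
    · intro k _
      have m1 : Measurable fun x => hsL h k (u x) := ((hsL_cont h k).comp hu.continuous).measurable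
      have m2 : Measurable fun x => ‖fderiv ℝ u x‖ := hfd.norm.measurable
      fun_prop
  · rw [← ENNReal.ofReal_sum_of_nonneg]
    · apply ENNReal.ofReal_le_ofReal
      rw [← Finset.mul_sum, ← Finset.mul_sum]
      have e : ∀ N : ℕ, ∑ k ∈ Finset.range N, (hsR u M (k * h) ^ α - hsR u M ((k + 2 : ℝ) * h) ^ α) =
          hsR u M (0 * h) ^ α + hsR u M (1 * h) ^ α - hsR u M (N * h) ^ α - hsR u M ((N + 1 : ℝ) * h) ^ α := by
        intro N
        induction N with
        | zero => simp
        | succ n ih =>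
          rw [Finset.sum_range_succ, ih]; push_cast
          rw [show (n + 1 + 1 : ℝ) = n + 2 by ring]; ring
      rw [e]
      have b : ∀ t, hsR u M t ^ α ≤ M ^ α := fun t =>
        rpow_le_rpow (hsR_nonneg u hM.le t) (hsR_le u hM.le t) h0.le
      have p : ∀ t, 0 ≤ hsR u M t ^ α := fun t => rpow_nonneg (hsR_nonneg u hM.le t) _
      rw [show 4 / α * M ^ α = 2 / α * (2 * M ^ α) by ring]
      refine mul_le_mul_of_nonneg_left (mul_le_mul_of_nonneg_left ?_ (by positivity)) hh.le
      linarith [b (0 * h), b (1 * h), p (N * h), p ((N + 1 : ℝ) * h)]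
    · intro k _
      have := hmono (k * h) ((k + 2 : ℝ) * h) (by nlinarith)
      positivity


theorem hs_main {α M : ℝ} (h0 : 0 < α) (h1 : α < 1) (hM : 0 < M)
    {u : EuclideanSpace ℝ (Fin 2) → ℝ} (hu : ContDiff ℝ 1 u) (hu0 : ∀ x, 0 ≤ u x)
    (huM : ∀ x, M ≤ ‖x‖ → u x = 0) (hmax : ∀ x, u x ≤ u 0)
    (hconn : ∀ t', 0 < t' → t' < u 0 → IsPreconnected {x | t' < u x}) :
    eLpNorm u (ENNReal.ofReal (2 / α)) volume ≤ ENNReal.ofReal (π ^ (α / 2) / (2 * π)) *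
      ∫⁻ x, ENNReal.ofReal (‖fderiv ℝ u x‖ * ‖x‖ ^ (α - 1)) := by
  set I := ∫⁻ x, ENNReal.ofReal (‖fderiv ℝ u x‖ * ‖x‖ ^ (α - 1)) with hI
  set κ := π ^ (α / 2) / (2 * π) with hκ
  have hκ0 : 0 < κ := by positivity
  set B : Set (EuclideanSpace ℝ (Fin 2)) := Metric.closedBall 0 M with hB
  have hBfin : volume B ≠ ⊤ := measure_closedBall_lt_top.ne
  have hBm : MeasurableSet B := measurableSet_closedBall
  have hr2 : 2 < 2 / α := by rw [lt_div_iff₀ h0]; linarith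
  have hp1 : (1 : ENNReal) ≤ ENNReal.ofReal (2 / α) := by
    rw [← ENNReal.ofReal_one]; exact ENNReal.ofReal_le_ofReal (by linarith)
  have hp0 : ENNReal.ofReal (2 / α) ≠ 0 := by
    intro h; rw [h] at hp1; simp at hp1
  have hpr : 1 / (ENNReal.ofReal (2 / α)).toReal = α / 2 := by
    rw [ENNReal.toReal_ofReal (by linarith)]; field_simp
  set D : ℝ := 2 * (volume B).toReal ^ (α / 2) + κ * (4 / α * M ^ α) with hD
  have hD0 : 0 < D := by positivity
  have key : ∀ h : ℝ, 0 < h → eLpNorm u (ENNReal.ofReal (2 / α)) volume ≤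
      ENNReal.ofReal κ * I + ENNReal.ofReal (h * D) := by
    intro h hh
    obtain ⟨N, hN⟩ := exists_nat_ge (u 0 / h)
    have hN' : u 0 ≤ (N + 2 : ℝ) * h := by
      rw [div_le_iff₀ hh] at hN; nlinarith
    set Z : ℕ → Set (EuclideanSpace ℝ (Fin 2)) := fun k => {x | (k + 2 : ℝ) * h ≤ u x} with hZ
    have hZm : ∀ k, MeasurableSet (Z k) := fun k =>
      measurableSet_le measurable_const hu.continuous.measurable
    have hZB : ∀ k, Z k ⊆ B := by
      intro k x hx
      have hx' : (k + 2 : ℝ) * h ≤ u x := hx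
      rw [hB, mem_closedBall_zero_iff]
      by_contra hc
      rw [huM x (not_le.mp hc).le] at hx'
      have : 0 < (k + 2 : ℝ) * h := by positivity
      linarith
    have hZfin : ∀ k, volume (Z k) ≠ ⊤ := fun k =>
      ((measure_mono (hZB k)).trans_lt hBfin.lt_top).ne
    set f : EuclideanSpace ℝ (Fin 2) → ℝ := B.indicator (fun _ => 2 * h) with hf
    set g : ℕ → EuclideanSpace ℝ (Fin 2) → ℝ := fun k => (Z k).indicator (fun _ => h) with hg
    have hgm : ∀ k, AEStronglyMeasurable (g k) volume := fun k =>
      (aestronglyMeasurable_const.indicator (hZm k))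
    have hfm : AEStronglyMeasurable f volume := aestronglyMeasurable_const.indicator hBm
    have hpt : ∀ x, ‖u x‖ ≤ (f + ∑ k ∈ Finset.range N, g k) x := by
      intro x
      rw [Real.norm_of_nonneg (hu0 x), Pi.add_apply, Finset.sum_apply]
      by_cases hx : x ∈ B
      · have h3 := hs_layer hh N (u x)
        rw [min_eq_left ((hmax x).trans hN')] at h3
        rw [hf, Set.indicator_of_mem hx]
        refine h3.trans (add_le_add_right (Finset.sum_le_sum fun k _ => ?_) _)
        simp only [hg, hZ, Set.indicator_apply, Set.mem_ofPred_eq]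
        exact le_refl _
      · have : u x = 0 := huM x (by
          rw [hB, mem_closedBall_zero_iff] at hx; exact (not_le.mp hx).le)
        rw [this]
        refine add_nonneg (Set.indicator_nonneg (fun _ _ => by positivity) _)
          (Finset.sum_nonneg fun k _ => Set.indicator_nonneg (fun _ _ => hh.le) _)
    have e1 : eLpNorm u (ENNReal.ofReal (2 / α)) volume ≤
        eLpNorm f (ENNReal.ofReal (2 / α)) volume +
          ∑ k ∈ Finset.range N, eLpNorm (g k) (ENNReal.ofReal (2 / α)) volume := by
      refine (eLpNorm_mono_real hpt).trans ?_
      refine (eLpNorm_add_le hfm (Finset.aestronglyMeasurable_sum _ fun k _ => hgm k) hp1).trans ?_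
      exact add_le_add_right (eLpNorm_sum_le (fun k _ => hgm k) hp1) _
    have ef : eLpNorm f (ENNReal.ofReal (2 / α)) volume =
        ENNReal.ofReal (h * (2 * (volume B).toReal ^ (α / 2))) := by
      rw [hf, eLpNorm_indicator_const hBm hp0 ENNReal.ofReal_ne_top, hpr,
        Real.enorm_of_nonneg (by positivity), ← ENNReal.ofReal_toReal hBfin,
        ENNReal.ofReal_rpow_of_nonneg ENNReal.toReal_nonneg (by positivity),
        ← ENNReal.ofReal_mul (by positivity), ENNReal.toReal_ofReal ENNReal.toReal_nonneg]
      congr 1; ring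
    have eg : ∀ k, eLpNorm (g k) (ENNReal.ofReal (2 / α)) volume =
        ENNReal.ofReal κ * ENNReal.ofReal (h * (2 * π * ((volume (Z k)).toReal / π) ^ (α / 2))) := by
      intro k
      have hv : 0 ≤ (volume (Z k)).toReal := ENNReal.toReal_nonneg
      rw [hg]
      simp only []
      rw [eLpNorm_indicator_const (hZm k) hp0 ENNReal.ofReal_ne_top, hpr,
        Real.enorm_of_nonneg hh.le, ← ENNReal.ofReal_mul hκ0.le]
      conv_lhs => rw [← ENNReal.ofReal_toReal (hZfin k)]
      rw [ENNReal.ofReal_rpow_of_nonneg hv (by positivity), ← ENNReal.ofReal_mul hh.le,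
        div_rpow hv pi_pos.le, hκ]
      congr 1
      have : π ^ (α / 2) ≠ 0 := by positivity
      field_simp
    have e2 := hs_sum h0 h1 hM hh hu huM hmax hconn N
    calc _ ≤ _ := e1
      _ = ENNReal.ofReal (h * (2 * (volume B).toReal ^ (α / 2))) + ENNReal.ofReal κ *
          ∑ k ∈ Finset.range N,
            ENNReal.ofReal (h * (2 * π * ((volume (Z k)).toReal / π) ^ (α / 2))) := by
          rw [ef, Finset.mul_sum]; simp_rw [eg]
      _ ≤ ENNReal.ofReal (h * (2 * (volume B).toReal ^ (α / 2))) + ENNReal.ofReal κ *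
          (I + ENNReal.ofReal (h * (4 / α * M ^ α))) := by
          exact add_le_add_right (mul_le_mul_right e2 _) _
      _ = _ := by
          rw [mul_add, ← ENNReal.ofReal_mul hκ0.le, add_left_comm,
            ← ENNReal.ofReal_add (by positivity) (by positivity), hD]
          congr 2; ring
  refine ENNReal.le_of_forall_pos_le_add fun ε hε _ => ?_
  have := key (ε / D) (div_pos (by exact_mod_cast hε) hD0)
  rwa [div_mul_cancel₀ _ hD0.ne', ENNReal.ofReal_coe_nnreal] at this

theorem hs_fin {α M : ℝ} (h0 : 0 < α) (hM : 0 < M)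
    {u : EuclideanSpace ℝ (Fin 2) → ℝ} (hu : ContDiff ℝ 1 u) (hs : HasCompactSupport u)
    (huM : ∀ x, M ≤ ‖x‖ → u x = 0) :
    ∫⁻ x, ENNReal.ofReal (‖fderiv ℝ u x‖ * ‖x‖ ^ (α - 1)) ≠ ⊤ := by
  have hfd : Continuous (fderiv ℝ u) := hu.continuous_fderiv one_ne_zero
  obtain ⟨C, hC⟩ := (hs.fderiv (𝕜 := ℝ)).exists_bound_of_continuous hfd
  have hC0 : 0 ≤ C := (norm_nonneg _).trans (hC 0)
  have hz : ∀ x, M < ‖x‖ → fderiv ℝ u x = 0 := by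
    intro x hx
    have : u =ᶠ[nhds x] fun _ => 0 := by
      filter_upwards [continuous_norm.continuousAt.eventually (lt_mem_nhds hx)] with y hy
      exact huM y (le_of_lt hy)
    rw [this.fderiv_eq]; simp
  have hm : Measurable fun x => ENNReal.ofReal (‖fderiv ℝ u x‖ * ‖x‖ ^ (α - 1)) := by
    have m2 : Measurable fun x => ‖fderiv ℝ u x‖ := hfd.norm.measurable
    fun_prop
  rw [hs_polar hm]
  refine ne_top_of_le_ne_top (b := ∫⁻ θ in Set.Ioo (-π) π, ENNReal.ofReal (M ^ α * C) * ENNReal.ofReal M) ?_ ?_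
  · rw [setLIntegral_const]
    exact ENNReal.mul_ne_top (ENNReal.mul_ne_top ENNReal.ofReal_ne_top ENNReal.ofReal_ne_top) (by simp)
  · refine lintegral_mono fun θ => ?_
    calc _ ≤ ∫⁻ ρ in Set.Ioi (0:ℝ), (Set.Ioc 0 M).indicator (fun _ => ENNReal.ofReal (M ^ α * C)) ρ := by
          refine setLIntegral_mono' measurableSet_Ioi fun ρ hρ => ?_
          have hρ : 0 < ρ := hρ
          have hn : ‖hsP ρ θ‖ = ρ := by rw [hsP_norm, abs_of_pos hρ]
          by_cases hρM : ρ ≤ M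
          · rw [Set.indicator_of_mem (show ρ ∈ Set.Ioc 0 M from ⟨hρ, hρM⟩), ← ENNReal.ofReal_mul hρ.le, hn]
            apply ENNReal.ofReal_le_ofReal
            have e : ρ * ρ ^ (α - 1) = ρ ^ α := by
              rw [rpow_sub_one hρ.ne']; field_simp
            calc ρ * (‖fderiv ℝ u (hsP ρ θ)‖ * ρ ^ (α - 1))
                = ρ ^ α * ‖fderiv ℝ u (hsP ρ θ)‖ := by rw [← e]; ring
              _ ≤ M ^ α * C := mul_le_mul (rpow_le_rpow hρ.le hρM h0.le) (hC _)
                  (norm_nonneg _) (by positivity)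
          · rw [hz _ (by rw [hn]; exact not_le.mp hρM)]
            simp
      _ ≤ ∫⁻ ρ, (Set.Ioc 0 M).indicator (fun _ => ENNReal.ofReal (M ^ α * C)) ρ :=
          setLIntegral_le_lintegral _ _
      _ = _ := by
          rw [lintegral_indicator measurableSet_Ioc, setLIntegral_const, Real.volume_Ioc, sub_zero]

theorem hs_pos {α M : ℝ} (h0 : 0 < α) (h1 : α < 1) (hM : 0 < M)
    {u : EuclideanSpace ℝ (Fin 2) → ℝ} (hu : ContDiff ℝ 1 u) (hs : HasCompactSupport u)
    (hu0 : ∀ x, 0 ≤ u x)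
    (huM : ∀ x, M ≤ ‖x‖ → u x = 0) (hmax : ∀ x, u x ≤ u 0)
    (hconn : ∀ t', 0 < t' → t' < u 0 → IsPreconnected {x | t' < u x}) :
    (∫ x, |u x| ^ (2 / α)) ^ (α / 2) ≤
      π ^ (α / 2) / (2 * π) * ∫ x, ‖fderiv ℝ u x‖ * ‖x‖ ^ (α - 1) := by
  have hr0 : 0 < 2 / α := by positivity
  have hfd : Continuous (fderiv ℝ u) := hu.continuous_fderiv one_ne_zero
  have h := hs_main h0 h1 hM hu hu0 huM hmax hconn
  have hm : MemLp u (ENNReal.ofReal (2 / α)) volume := hu.continuous.memLp_of_hasCompactSupport hs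
  rw [hm.eLpNorm_eq_integral_rpow_norm (by simpa using hr0) ENNReal.ofReal_ne_top,
    ENNReal.toReal_ofReal hr0.le] at h
  have hmeas : Measurable fun x => ‖fderiv ℝ u x‖ * ‖x‖ ^ (α - 1) := by
    have m2 : Measurable fun x => ‖fderiv ℝ u x‖ := hfd.norm.measurable
    fun_prop
  have e : ∫⁻ x, ENNReal.ofReal (‖fderiv ℝ u x‖ * ‖x‖ ^ (α - 1)) =
      ENNReal.ofReal (∫ x, ‖fderiv ℝ u x‖ * ‖x‖ ^ (α - 1)) := by
    rw [integral_eq_lintegral_of_nonneg_ae (Filter.Eventually.of_forall fun x => by positivity)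
      hmeas.aestronglyMeasurable, ENNReal.ofReal_toReal (hs_fin h0 hM hu hs huM)]
  have hintg : 0 ≤ ∫ x, ‖fderiv ℝ u x‖ * ‖x‖ ^ (α - 1) := integral_nonneg fun x => by positivity
  rw [e, ← ENNReal.ofReal_mul (by positivity), ENNReal.ofReal_le_ofReal_iff (by positivity),
    inv_div] at h
  simpa only [Real.norm_eq_abs] using h

/-- Theorem 3.2 (ii): for `p ∈ (-1,0)` and `r = 2/(p+1)`, the Hardy–Sobolev
inequality with constant `π^{1/r}/(2π)` holds for every `u ∈ C_c^∞(ℝ²)` all of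
whose level sets `Ω_u(t) = {|u| > t}`, `0 < t < max |u|`, are connected and
contain the origin. -/
theorem hardy_sobolev_negative_p
    (p : ℝ) (hp0 : -1 < p) (hp1 : p < 0) (r : ℝ) (hr : r = 2 / (p + 1))
    (u : EuclideanSpace ℝ (Fin 2) → ℝ)
    (hu : ContDiff ℝ (⊤ : ℕ∞) u) (hsupp : HasCompactSupport u)
    (hlevel : ∀ t : ℝ, 0 < t → t < ⨆ x, |u x| →
      IsConnected {x : EuclideanSpace ℝ (Fin 2) | t < |u x|} ∧
        (0 : EuclideanSpace ℝ (Fin 2)) ∈ {x : EuclideanSpace ℝ (Fin 2) | t < |u x|}) :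
    (∫ x, |u x| ^ r) ^ (1 / r) ≤
      π ^ (1 / r) / (2 * π) * ∫ x, ‖fderiv ℝ u x‖ * ‖x‖ ^ p := by
  have h0 : 0 < p + 1 := by linarith
  have h1 : p + 1 < 1 := by linarith
  have hrinv : 1 / r = (p + 1) / 2 := by rw [hr, one_div_div]
  have hu1 : ContDiff ℝ 1 u := hu.of_le (by exact_mod_cast le_top)
  obtain ⟨C, hC⟩ := hsupp.exists_bound_of_continuous hu.continuous
  have hbdd : BddAbove (Set.range fun x => |u x|) := ⟨C, by rintro _ ⟨x, rfl⟩; exact hC x⟩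
  have hle : ∀ x, |u x| ≤ ⨆ x, |u x| := fun x => le_ciSup hbdd x
  have hmax : ∀ x, |u x| ≤ |u 0| := by
    intro x
    by_contra hc
    push Not at hc
    rcases (abs_nonneg (u 0)).eq_or_lt with h | h
    · have hx : 0 < |u x| := by rwa [h]
      have := (hlevel (|u x| / 2) (by linarith) (by linarith [hle x])).2
      rw [Set.mem_ofPred_eq] at this
      linarith
    · have := (hlevel (|u 0|) h (hc.trans_le (hle x))).2
      rw [Set.mem_ofPred_eq] at this
      linarith
  have hsup : ⨆ x, |u x| = |u 0| := le_antisymm (ciSup_le hmax) (hle 0)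
  rw [hsup] at hlevel
  obtain ⟨M, hM, hMs⟩ := hsupp.isCompact.isBounded.subset_ball_lt 0 0
  have huM : ∀ x, M ≤ ‖x‖ → u x = 0 := by
    intro x hx
    by_contra hc
    have := hMs (subset_tsupport u hc)
    rw [mem_ball_zero_iff] at this
    linarith
  have main : ∀ v : EuclideanSpace ℝ (Fin 2) → ℝ, ContDiff ℝ 1 v → HasCompactSupport v →
      0 ≤ v 0 → (∀ x, |v x| = |u x|) → (∀ x, ‖fderiv ℝ v x‖ = ‖fderiv ℝ u x‖) →
      (∫ x, |u x| ^ r) ^ (1 / r) ≤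
      π ^ (1 / r) / (2 * π) * ∫ x, ‖fderiv ℝ u x‖ * ‖x‖ ^ p := by
    intro v hv hvs hv0 hvu hvf
    have hv00 : v 0 = |u 0| := by rw [← hvu, abs_of_nonneg hv0]
    have hpos : ∀ x, 0 ≤ v x := by
      intro x
      by_contra hc
      push Not at hc
      have hx : 0 < |u x| := by rw [← hvu]; exact abs_pos.mpr hc.ne
      obtain ⟨hcn, hz⟩ := hlevel (|u x| / 2) (by linarith) (by linarith [hmax x])
      have hxm : x ∈ {y : EuclideanSpace ℝ (Fin 2) | |u x| / 2 < |u y|} := by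
        rw [Set.mem_ofPred_eq]; linarith
      obtain ⟨y, hy, hy0⟩ := hcn.isPreconnected.intermediate_value hxm hz
        hv.continuous.continuousOn ⟨hc.le, hv0⟩
      rw [Set.mem_ofPred_eq, ← hvu y, hy0, abs_zero] at hy
      linarith
    have hveq : ∀ x, v x = |u x| := fun x => by rw [← hvu, abs_of_nonneg (hpos x)]
    have key := hs_pos h0 h1 hM hv hvs hpos
      (fun x hx => by rw [hveq, huM x hx, abs_zero])
      (fun x => by rw [hveq, hveq]; exact hmax x)
      (fun t ht ht' => by
        rw [hv00] at ht'
        have := (hlevel t ht ht').1.isPreconnected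
        simpa only [hveq] using this)
    simp only [hvu, hvf, add_sub_cancel_right] at key
    rw [hrinv, hr]
    exact key
  rcases le_total 0 (u 0) with h | h
  · exact main u hu1 hsupp h (fun _ => rfl) (fun _ => rfl)
  · refine main (fun x => -u x) hu1.neg hsupp.neg (by simpa using h) (fun x => abs_neg _) fun x => ?_
    rw [fderiv_fun_neg, norm_neg]
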